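/- Let F be a finite field with q elements and characteristic p (p odd). Let k ≥ 1 and let b₁ < b₂ < ... < b_k be strictly increasing integers (possibly negative) each coprime with p (p ∤ b_i), and set d := max(b_k, 0) − min(b₁, 0) + 1. Then for any elements a₁, ..., a_k of F and M chosen uniformly at random from SL_n(F) (invertible n×n matrices of determinant 1 over F), | Pr[ trace(M^{b_i}) = a_i for all 1 ≤ i ≤ k ] − q^{−k} | ≤ q^{−n²/(2d)} · (q−1) · (1 + 1/(q−1))^n · binom(n+d, n), where M^{b_i} is the b_i-th group power of M (negative exponents use M⁻¹) and trace is the matrix trace. -/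

import Mathlib

namespace TraceEquidistribution

open Polynomial

section MatrixRecursion

variable {F : Type*} [Field F]

/-- The monic polynomial of degree `r` with lower coefficients `y`. -/
noncomputable def monicPoly {r : ℕ} (y : Fin r → F) : F[X] :=
  X ^ r + ∑ i, C (y i) * X ^ (i : ℕ)

lemma degree_monicPoly_tail {r : ℕ} (y : Fin r → F) :
    (∑ i, C (y i) * X ^ (i : ℕ)).degree < (r : WithBot ℕ) := by
  refine (Polynomial.degree_sum_le _ _).trans_lt ?_
  refine (Finset.sup_lt_iff (WithBot.bot_lt_coe r)).2 fun i _ => ?_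
  exact (degree_C_mul_X_pow_le _ _).trans_lt (Nat.cast_lt.2 i.2)

lemma monic_monicPoly {r : ℕ} (y : Fin r → F) : (monicPoly y).Monic :=
  monic_X_pow_add (degree_monicPoly_tail y)

lemma natDegree_monicPoly {r : ℕ} (y : Fin r → F) : (monicPoly y).natDegree = r := by
  refine natDegree_eq_of_degree_eq_some ?_
  rw [monicPoly, degree_add_eq_left_of_degree_lt, degree_X_pow]
  rw [degree_X_pow]
  exact degree_monicPoly_tail y

lemma coeff_monicPoly {r : ℕ} (y : Fin r → F) (i : Fin r) : (monicPoly y).coeff i = y i := by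
  have hi : (i : ℕ) ≠ r := i.2.ne
  simp [monicPoly, coeff_X_pow, hi, Fin.val_inj]

lemma monicPoly_coeff {r : ℕ} {f : F[X]} (hf : f.Monic) (hr : f.natDegree = r) :
    monicPoly (fun i : Fin r => f.coeff i) = f := by
  ext i
  rcases lt_trichotomy i r with h | rfl | h
  · exact coeff_monicPoly (fun i : Fin r => f.coeff i) ⟨i, h⟩
  · have h1 := monic_monicPoly (fun j : Fin i => f.coeff j)
    rw [Monic, leadingCoeff, natDegree_monicPoly] at h1
    rw [h1, ← hr]
    exact hf.symm
  · rw [coeff_eq_zero_of_natDegree_lt (by rwa [natDegree_monicPoly]),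
      coeff_eq_zero_of_natDegree_lt (by rwa [hr])]

lemma monicPoly_injective {r : ℕ} : Function.Injective (monicPoly : (Fin r → F) → F[X]) := by
  intro y z h
  ext i
  rw [← coeff_monicPoly y, h, coeff_monicPoly]

/-- The companion matrix of `monicPoly y`. -/
def companion {r : ℕ} (y : Fin r → F) : Matrix (Fin r) (Fin r) F :=
  Matrix.of fun i j => if (j : ℕ) + 1 = r then -y i else if (i : ℕ) = j + 1 then 1 else 0

lemma charpoly_companion {r : ℕ} (y : Fin r → F) : (companion y).charpoly = monicPoly y := by
  have hm := monic_monicPoly y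
  have hd : (AdjoinRoot.powerBasis hm.ne_zero).dim = r := by
    rw [AdjoinRoot.powerBasis_dim, natDegree_monicPoly]
  have hmin : minpoly F (AdjoinRoot.powerBasis hm.ne_zero).gen = monicPoly y := by
    rw [AdjoinRoot.minpoly_powerBasis_gen, hm.leadingCoeff]
    simp
  have h := charpoly_leftMulMatrix (AdjoinRoot.powerBasis hm.ne_zero)
  rw [hmin, PowerBasis.leftMulMatrix, PowerBasis.minpolyGen_eq, hmin] at h
  rw [← Matrix.charpoly_reindex (finCongr hd)] at h
  rw [← h]
  congr 1
  ext i j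
  simp only [companion, Matrix.of_apply, Matrix.reindex_apply, Matrix.submatrix_apply,
    finCongr_symm, finCongr_apply, Fin.val_cast, hd, coeff_monicPoly]

variable {V : Type*} [AddCommGroup V] [Module F V]

/-- `w` is the Krylov basis of the `φ`-invariant subspace generated by `v`. -/
def IsKrylov {r : ℕ} (w : Fin r → V) (φ : V →ₗ[F] V) (v : V) : Prop :=
  (∀ i : Fin r, (φ ^ (i : ℕ)) v = w i) ∧ (φ ^ r) v ∈ Submodule.span F (Set.range w)

lemma exists_krylov [FiniteDimensional F V] (φ : V →ₗ[F] V) (v : V) :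
    ∃ r ≤ Module.finrank F V, ∃ w : Fin r → V, LinearIndependent F w ∧ IsKrylov w φ v := by
  classical
  have key : ∀ r : ℕ, LinearIndependent F (fun i : Fin r => (φ ^ (i : ℕ)) v) ∨
      ∃ s < r, ∃ w : Fin s → V, LinearIndependent F w ∧ IsKrylov w φ v := by
    intro r
    induction r with
    | zero => exact Or.inl linearIndependent_empty_type
    | succ r ih =>
      rcases ih with ih | ⟨s, hs, h⟩
      · by_cases hr : (φ ^ r) v ∈ Submodule.span F (Set.range fun i : Fin r => (φ ^ (i : ℕ)) v)
        · exact Or.inr ⟨r, r.lt_succ_self, _, ih, fun i => rfl, hr⟩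
        · left
          have := linearIndependent_finSnoc.2 ⟨ih, hr⟩
          convert this using 1
          ext i
          refine Fin.lastCases ?_ (fun i => ?_) i <;> simp
      · exact Or.inr ⟨s, hs.trans r.lt_succ_self, h⟩
  rcases key (Module.finrank F V + 1) with h | ⟨s, hs, h⟩
  · have := h.fintype_card_le_finrank
    simp at this
  · exact ⟨s, Nat.lt_succ_iff.1 hs, h⟩

lemma IsKrylov.le {r s : ℕ} {w : Fin r → V} {u : Fin s → V} {φ : V →ₗ[F] V} {v : V}
    (hw : IsKrylov w φ v) (hu : LinearIndependent F u) (hu' : IsKrylov u φ v) : s ≤ r := by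
  by_contra! hrs
  have h1 := hw.2
  have h2 : (φ ^ r) v = u ⟨r, hrs⟩ := hu'.1 ⟨r, hrs⟩
  rw [h2] at h1
  have h3 : Set.range w ⊆ u '' (Set.univ \ {⟨r, hrs⟩}) := by
    rintro _ ⟨i, rfl⟩
    refine ⟨⟨i, i.2.trans hrs⟩, ⟨trivial, ?_⟩, ?_⟩
    · simp only [Set.mem_singleton_iff, Fin.mk.injEq]
      exact i.2.ne
    · rw [← hw.1 i, ← hu'.1]
  exact (linearIndependent_iff_notMem_span.1 hu ⟨r, hrs⟩) (Submodule.span_mono (by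
    simpa using h3) h1)

lemma exists_basis_extending [FiniteDimensional F V] {r s : ℕ} (hV : Module.finrank F V = r + s)
    {w : Fin r → V} (hw : LinearIndependent F w) :
    ∃ b : Module.Basis (Fin r ⊕ Fin s) F V, ∀ i, b (Sum.inl i) = w i := by
  classical
  let b₀ := Module.Basis.sumExtend hw
  have : Finite (Fin r ⊕ Module.Basis.sumExtendIndex hw) := Module.Finite.finite_basis b₀
  have : Finite (Module.Basis.sumExtendIndex hw) :=
    Finite.of_injective (Sum.inr : _ → Fin r ⊕ Module.Basis.sumExtendIndex hw) Sum.inr_injective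
  have hc : Nat.card (Module.Basis.sumExtendIndex hw) = s := by
    have := Module.finrank_eq_nat_card_basis b₀
    rw [hV, Nat.card_sum, Nat.card_fin] at this
    omega
  let e := Finite.equivFinOfCardEq hc
  refine ⟨b₀.reindex (Equiv.sumCongr (Equiv.refl _) e), fun i => ?_⟩
  simp [b₀, Module.Basis.sumExtend]
  rfl

end MatrixRecursion

section MatrixRecursion

variable {F : Type*} [Field F]

variable {V : Type*} [AddCommGroup V] [Module F V]

/-- The block upper triangular endomorphism with a companion block. -/
noncomputable def blockEnd {r s : ℕ} (b : Module.Basis (Fin r ⊕ Fin s) F V)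
    (t : (Fin r → F) × Matrix (Fin r) (Fin s) F × Matrix (Fin s) (Fin s) F) : V →ₗ[F] V :=
  Matrix.toLin b b (Matrix.fromBlocks (companion t.1) t.2.1 0 t.2.2)

lemma charpoly_blockEnd [FiniteDimensional F V] {r s : ℕ} (b : Module.Basis (Fin r ⊕ Fin s) F V)
    (t : (Fin r → F) × Matrix (Fin r) (Fin s) F × Matrix (Fin s) (Fin s) F) :
    (blockEnd b t).charpoly = monicPoly t.1 * t.2.2.charpoly := by
  rw [← LinearMap.charpoly_toMatrix (blockEnd b t) b, blockEnd, LinearMap.toMatrix_toLin,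
    Matrix.charpoly_fromBlocks_zero₂₁, charpoly_companion]

lemma blockEnd_inl {r s : ℕ} (b : Module.Basis (Fin r ⊕ Fin s) F V)
    (t : (Fin r → F) × Matrix (Fin r) (Fin s) F × Matrix (Fin s) (Fin s) F) (j : Fin r) :
    blockEnd b t (b (Sum.inl j)) = ∑ i, companion t.1 i j • b (Sum.inl i) := by
  rw [blockEnd, Matrix.toLin_self, Fintype.sum_sum_type]
  simp

/-- The first vector of a tuple, or zero if the tuple is empty. -/
def firstVec {r : ℕ} (w : Fin r → V) : V := if h : 0 < r then w ⟨0, h⟩ else 0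

lemma IsKrylov.eq_firstVec {r : ℕ} {w : Fin r → V} {φ : V →ₗ[F] V} {v : V}
    (h : IsKrylov w φ v) : v = firstVec w := by
  unfold firstVec
  split_ifs with hr
  · simpa using h.1 ⟨0, hr⟩
  · obtain rfl : r = 0 := by omega
    simpa using h.2

lemma isKrylov_blockEnd {r s : ℕ} (b : Module.Basis (Fin r ⊕ Fin s) F V)
    (t : (Fin r → F) × Matrix (Fin r) (Fin s) F × Matrix (Fin s) (Fin s) F) :
    IsKrylov (fun i => b (Sum.inl i)) (blockEnd b t) (firstVec fun i => b (Sum.inl i)) := by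
  have h1 : ∀ i (hi : i < r), (blockEnd b t ^ i) (firstVec fun i => b (Sum.inl i)) =
      b (Sum.inl ⟨i, hi⟩) := by
    intro i
    induction i with
    | zero => intro hi; simp [firstVec, hi]
    | succ i ih =>
      intro hi
      rw [pow_succ', Module.End.mul_apply, ih (by omega), blockEnd_inl,
        Finset.sum_eq_single ⟨i + 1, hi⟩]
      · simp [companion, hi.ne]
      · intro j _ hj
        have : (j : ℕ) ≠ i + 1 := fun h => hj (Fin.ext h)
        simp [companion, hi.ne, this]
      · simp
  refine ⟨fun i => h1 i i.2, ?_⟩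
  rcases Nat.eq_zero_or_pos r with rfl | hr
  · simp [firstVec]
  · obtain ⟨r, rfl⟩ := Nat.exists_eq_succ_of_ne_zero hr.ne'
    rw [pow_succ', Module.End.mul_apply, h1 r r.lt_succ_self, blockEnd_inl]
    exact Submodule.sum_mem _ fun i _ => Submodule.smul_mem _ _ (Submodule.subset_span ⟨i, rfl⟩)

lemma companion_injective {r : ℕ} : Function.Injective (companion : (Fin r → F) → _) := by
  intro y z h
  rcases r with _ | r
  · exact Subsingleton.elim _ _
  · ext i
    have := congr_fun (congr_fun h i) (Fin.last r)
    simpa [companion] using this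

lemma blockEnd_injective {r s : ℕ} (b : Module.Basis (Fin r ⊕ Fin s) F V) :
    Function.Injective (blockEnd b) := by
  rintro ⟨y, U, M⟩ ⟨y', U', M'⟩ h
  have := (Matrix.toLin b b).injective h
  rw [Matrix.fromBlocks_inj] at this
  obtain ⟨h1, h2, -, h3⟩ := this
  rw [Prod.mk.injEq, Prod.mk.injEq]
  exact ⟨companion_injective h1, h2, h3⟩

lemma IsKrylov.exists_blockEnd {r s : ℕ} (b : Module.Basis (Fin r ⊕ Fin s) F V)
    {φ : V →ₗ[F] V} {v : V} (h : IsKrylov (fun i => b (Sum.inl i)) φ v) :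
    ∃ t, blockEnd b t = φ := by
  obtain ⟨c, hc⟩ := (Submodule.mem_span_range_iff_exists_fun F).1 h.2
  set B := LinearMap.toMatrix b b φ with hB
  refine ⟨(fun i => -c i, B.toBlocks₁₂, B.toBlocks₂₂), ?_⟩
  have key : ∀ j : Fin r, φ (b (Sum.inl j)) =
      ∑ i, companion (fun i => -c i) i j • b (Sum.inl i) := by
    intro j
    have hj : φ (b (Sum.inl j)) = (φ ^ ((j : ℕ) + 1)) v := by
      rw [pow_succ', Module.End.mul_apply, h.1]
    rw [hj]
    rcases (Nat.succ_le_of_lt j.2).eq_or_lt with hjr | hjr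
    · have hjr' : (j : ℕ) + 1 = r := hjr
      simp only [companion, hjr', Matrix.of_apply, if_true, neg_neg, hc]
    · have hjr' : (j : ℕ) + 1 ≠ r := hjr.ne
      rw [h.1 ⟨j + 1, hjr⟩, Finset.sum_eq_single ⟨j + 1, hjr⟩]
      · simp [companion, hjr']
      · intro i _ hi
        have : (i : ℕ) ≠ j + 1 := fun h => hi (Fin.ext h)
        simp [companion, hjr', this]
      · simp
  refine b.ext fun j => ?_
  rcases j with j | j
  · rw [blockEnd_inl, key]
  · rw [blockEnd, Matrix.toLin_self, ← b.sum_repr (φ (b (Sum.inr j))), Fintype.sum_sum_type,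
      Fintype.sum_sum_type]
    simp [hB, LinearMap.toMatrix_apply, Matrix.toBlocks₁₂, Matrix.toBlocks₂₂]

open Classical in
lemma sum_krylov [Fintype F] [Fintype V] [Fintype (V →ₗ[F] V)] (χ : F[X] →* ℂ) {r s : ℕ}
    (hV : Module.finrank F V = r + s) {w : Fin r → V} (hw : LinearIndependent F w) :
    ∑ φ : V →ₗ[F] V, ∑ v : V, (if IsKrylov w φ v then χ φ.charpoly else 0) =
      (Fintype.card F : ℂ) ^ (r * s) * (∑ y : Fin r → F, χ (monicPoly y)) *
        ∑ M : Matrix (Fin s) (Fin s) F, χ M.charpoly := by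
  obtain ⟨b, hb⟩ := exists_basis_extending hV hw
  obtain rfl : w = fun i => b (Sum.inl i) := funext fun i => (hb i).symm
  have h1 : ∀ φ : V →ₗ[F] V, ∑ v : V, (if IsKrylov (fun i => b (Sum.inl i)) φ v then
      χ φ.charpoly else 0) = if ∃ t, blockEnd b t = φ then χ φ.charpoly else 0 := by
    intro φ
    rw [Finset.sum_eq_single (firstVec fun i => b (Sum.inl i))]
    · congr 1
      rw [eq_iff_iff]
      exact ⟨fun h => h.exists_blockEnd b, fun ⟨t, ht⟩ => ht ▸ isKrylov_blockEnd b t⟩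
    · intro v _ hv
      rw [if_neg fun h => hv h.eq_firstVec]
    · simp
  simp_rw [h1]
  rw [← Finset.sum_filter]
  have h2 : (Finset.univ.filter fun φ : V →ₗ[F] V => ∃ t, blockEnd b t = φ) =
      Finset.univ.image (blockEnd b) := by
    ext φ; simp
  rw [h2, Finset.sum_image (blockEnd_injective b).injOn]
  simp_rw [charpoly_blockEnd, map_mul, Fintype.sum_prod_type, ← Finset.mul_sum]
  rw [← Finset.sum_mul]
  have hc : Fintype.card (Matrix (Fin r) (Fin s) F) = Fintype.card F ^ (r * s) := by
    rw [← Fintype.card_congr (Matrix.of : (Fin r → Fin s → F) ≃ _)]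
    simp [← pow_mul, mul_comm]
  rw [Finset.sum_const, Finset.card_univ, hc, nsmul_eq_mul]
  push_cast
  ring

open Classical in
lemma sum_endomorphisms [Fintype F] [Fintype V] [Fintype (V →ₗ[F] V)] (χ : F[X] →* ℂ) {n : ℕ}
    (hV : Module.finrank F V = n) :
    (Fintype.card F : ℂ) ^ n * ∑ φ : V →ₗ[F] V, χ φ.charpoly =
      ∑ r ∈ Finset.range (n + 1), (Nat.card {w : Fin r → V // LinearIndependent F w} : ℂ) *
        ((Fintype.card F : ℂ) ^ (r * (n - r)) * (∑ y : Fin r → F, χ (monicPoly y)) *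
        ∑ M : Matrix (Fin (n - r)) (Fin (n - r)) F, χ M.charpoly) := by
  have h1 : ∀ (φ : V →ₗ[F] V) (v : V), χ φ.charpoly = ∑ r ∈ Finset.range (n + 1),
      ∑ w : {w : Fin r → V // LinearIndependent F w},
        if IsKrylov w.1 φ v then χ φ.charpoly else 0 := by
    intro φ v
    obtain ⟨r, hr, w, hw, hk⟩ := exists_krylov φ v
    rw [Finset.sum_eq_single r, Finset.sum_eq_single ⟨w, hw⟩, if_pos hk]
    · rintro ⟨u, hu⟩ _ hne
      rw [if_neg]
      intro hk'
      apply hne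
      ext i : 2
      exact (hk'.1 i).symm.trans (hk.1 i)
    · simp
    · intro s _ hs
      refine Finset.sum_eq_zero fun u _ => ?_
      rw [if_neg]
      exact fun hk' => hs (le_antisymm (hk.le u.2 hk') (hk'.le hw hk))
    · intro h
      exact absurd (Finset.mem_range.2 (by omega)) h
  have hVc : (Fintype.card V : ℂ) = (Fintype.card F : ℂ) ^ n := by
    rw [Module.card_eq_pow_finrank (K := F), hV]
    push_cast
    rfl
  calc (Fintype.card F : ℂ) ^ n * ∑ φ : V →ₗ[F] V, χ φ.charpoly
      = ∑ φ : V →ₗ[F] V, ∑ v : V, χ φ.charpoly := by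
        simp [Finset.sum_const, hVc, Finset.mul_sum]
    _ = ∑ φ : V →ₗ[F] V, ∑ v : V, ∑ r ∈ Finset.range (n + 1),
          ∑ w : {w : Fin r → V // LinearIndependent F w},
            if IsKrylov w.1 φ v then χ φ.charpoly else 0 :=
        Finset.sum_congr rfl fun φ _ => Finset.sum_congr rfl fun v _ => h1 φ v
    _ = ∑ r ∈ Finset.range (n + 1), ∑ w : {w : Fin r → V // LinearIndependent F w},
          ∑ φ : V →ₗ[F] V, ∑ v : V, if IsKrylov w.1 φ v then χ φ.charpoly else 0 := by
        simp_rw [Finset.sum_comm (s := (Finset.univ : Finset V)) (t := Finset.range (n + 1))]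
        rw [Finset.sum_comm]
        refine Finset.sum_congr rfl fun r _ => ?_
        simp_rw [Finset.sum_comm (s := (Finset.univ : Finset V))]
        rw [Finset.sum_comm]
    _ = _ := by
        refine Finset.sum_congr rfl fun r hr => ?_
        have hr' : r ≤ n := Nat.lt_succ_iff.1 (Finset.mem_range.1 hr)
        rw [Finset.sum_congr rfl fun w _ => sum_krylov χ
          (show Module.finrank F V = r + (n - r) by omega) w.2]
        rw [Finset.sum_const, Finset.card_univ, nsmul_eq_mul, Nat.card_eq_fintype_card]

/-- The normalized sum of `χ` over characteristic polynomials of `n × n` matrices. -/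
noncomputable def matrixMean [Fintype F] [DecidableEq F] (χ : F[X] →* ℂ) (n : ℕ) : ℂ :=
  (∑ M : Matrix (Fin n) (Fin n) F, χ M.charpoly) / (Nat.card (GL (Fin n) F) : ℂ)

/-- The sum of `χ` over monic polynomials of degree `r`. -/
noncomputable def monicSum [Fintype F] (χ : F[X] →* ℂ) (r : ℕ) : ℂ :=
  ∑ y : Fin r → F, χ (monicPoly y)

lemma card_GL_eq [Fintype F] {n r s : ℕ} (hn : n = r + s) :
    Nat.card {w : Fin r → (Fin n → F) // LinearIndependent F w} *
      (Fintype.card F ^ (r * s) * Nat.card (GL (Fin s) F)) = Nat.card (GL (Fin n) F) := by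
  subst hn
  rw [card_linearIndependent (by simp), Matrix.card_GL_field, Matrix.card_GL_field]
  simp only [Module.finrank_fintype_fun_eq_card, Fintype.card_fin]
  rw [Fin.prod_univ_add]
  simp only [Fin.val_castAdd, Fin.val_natAdd]
  congr 1
  have h : ∏ i : Fin s, Fintype.card F ^ r * (Fintype.card F ^ s - Fintype.card F ^ (i : ℕ)) =
      Fintype.card F ^ (r * s) * ∏ i : Fin s, (Fintype.card F ^ s - Fintype.card F ^ (i : ℕ)) := by
    rw [Finset.prod_mul_distrib]
    simp [pow_mul]
  rw [← h]
  refine Finset.prod_congr rfl fun i _ => ?_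
  rw [Nat.mul_sub, ← pow_add, ← pow_add]

theorem matrixMean_recursion [Fintype F] [DecidableEq F] (χ : F[X] →* ℂ) (n : ℕ) :
    (Fintype.card F : ℂ) ^ n * matrixMean χ n =
      ∑ r ∈ Finset.range (n + 1), monicSum χ r * matrixMean χ (n - r) := by
  have hG : ∀ m, (Nat.card (GL (Fin m) F) : ℂ) ≠ 0 := fun m =>
    Nat.cast_ne_zero.2 Nat.card_pos.ne'
  have : Finite ((Fin n → F) →ₗ[F] (Fin n → F)) :=
    Finite.of_injective _ (LinearMap.toMatrix' (R := F) (m := Fin n) (n := Fin n)).injective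
  have := Fintype.ofFinite ((Fin n → F) →ₗ[F] (Fin n → F))
  have h := sum_endomorphisms (V := Fin n → F) χ (n := n) (by simp)
  have h2 : ∑ φ : (Fin n → F) →ₗ[F] (Fin n → F), χ φ.charpoly =
      ∑ M : Matrix (Fin n) (Fin n) F, χ M.charpoly := by
    refine Fintype.sum_equiv LinearMap.toMatrix'.toEquiv _ _ fun φ => ?_
    rw [← LinearMap.charpoly_toMatrix φ (Pi.basisFun F (Fin n))]
    rfl
  rw [h2] at h
  rw [matrixMean, mul_div_assoc', h, Finset.sum_div]
  refine Finset.sum_congr rfl fun r hr => ?_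
  have hr' : r ≤ n := Nat.lt_succ_iff.1 (Finset.mem_range.1 hr)
  have hc := congr_arg (Nat.cast : ℕ → ℂ) (card_GL_eq (F := F) (show n = r + (n - r) by omega))
  push_cast at hc
  rw [matrixMean, monicSum, div_eq_iff (hG n), ← hc]
  have := hG (n - r)
  field_simp

end MatrixRecursion

section WeightSemigroup

/-- The exponents `(i, j)` with `j < q` whose weight `q * i + B * j` is at most `w`. -/
def weightBox (q B w : ℕ) : Finset (ℕ × ℕ) :=
  (Finset.range (w + 1) ×ˢ Finset.range q).filter fun e => q * e.1 + B * e.2 ≤ w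

lemma mem_weightBox {q B w : ℕ} (hq : 0 < q) {e : ℕ × ℕ} :
    e ∈ weightBox q B w ↔ e.2 < q ∧ q * e.1 + B * e.2 ≤ w := by
  simp only [weightBox, Finset.mem_filter, Finset.mem_product, Finset.mem_range]
  refine ⟨fun h => ⟨h.1.2, h.2⟩, fun h => ⟨⟨?_, h.1⟩, h.2⟩⟩
  have := Nat.le_mul_of_pos_left e.1 hq
  omega

lemma weight_injOn {q B : ℕ} (hqB : q.Coprime B) {e f : ℕ × ℕ} (he : e.2 < q) (hf : f.2 < q)
    (h : q * e.1 + B * e.2 = q * f.1 + B * f.2) : e = f := by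
  have h2 : B * e.2 ≡ B * f.2 [MOD q] := by
    have : (q * e.1 + B * e.2) % q = (q * f.1 + B * f.2) % q := by rw [h]
    simpa [Nat.ModEq, Nat.mul_add_mod] using this
  have h3 : e.2 = f.2 :=
    (Nat.ModEq.cancel_left_of_coprime hqB h2).eq_of_lt_of_lt he hf
  rw [h3, Nat.add_right_cancel_iff] at h
  exact Prod.ext (Nat.eq_of_mul_eq_mul_left (by omega) h) h3

lemma card_weightBox_le {q B : ℕ} (hq : 0 < q) (hqB : q.Coprime B) (w : ℕ) :
    (weightBox q B w).card ≤ w + 1 := by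
  rw [← Finset.card_range (w + 1)]
  refine Finset.card_le_card_of_injOn (fun e => q * e.1 + B * e.2) ?_ ?_
  · intro e he
    have := ((mem_weightBox hq).1 he).2
    simp only [Finset.coe_range, Set.mem_Iio]
    omega
  · intro e he f hf h
    exact weight_injOn hqB ((mem_weightBox hq).1 he).1 ((mem_weightBox hq).1 hf).1 h

lemma exists_weight_eq {q B : ℕ} (hq : 0 < q) (hqB : q.Coprime B) {w : ℕ} (hw : q * B ≤ w) :
    ∃ e : ℕ × ℕ, e.2 < q ∧ q * e.1 + B * e.2 = w := by
  obtain ⟨c, hc⟩ : ∃ c, B * c ≡ w [MOD q] := by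
    rcases Nat.lt_or_ge 1 q with h1 | h1
    · obtain ⟨c, hc⟩ := Nat.exists_mul_mod_eq_one_of_coprime hqB.symm h1
      refine ⟨c * w, ?_⟩
      have : B * c ≡ 1 [MOD q] := by rw [Nat.ModEq, hc.2, Nat.mod_eq_of_lt h1]
      simpa [mul_assoc] using this.mul_right w
    · obtain rfl : q = 1 := by omega
      exact ⟨0, Nat.modEq_one⟩
  have hlt : c % q < q := Nat.mod_lt _ hq
  have hle : B * (c % q) ≤ w := (Nat.mul_le_mul_left B hlt.le).trans (by rwa [mul_comm])
  have hmod : B * (c % q) ≡ w [MOD q] := ((Nat.mod_modEq c q).mul_left B).trans hc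
  obtain ⟨i, hi⟩ := (Nat.modEq_iff_dvd' hle).1 hmod
  exact ⟨(i, c % q), hlt, by simp only; omega⟩

lemma le_card_weightBox {q B : ℕ} (hq : 0 < q) (hqB : q.Coprime B) (w : ℕ) :
    w + 1 ≤ (weightBox q B w).card + q * B := by
  have h : (Finset.Ico (q * B) (w + 1)).card ≤ (weightBox q B w).card := by
    refine (Finset.card_le_card fun u hu => ?_).trans
      (Finset.card_image_le (f := fun e : ℕ × ℕ => q * e.1 + B * e.2))
    rw [Finset.mem_Ico] at hu
    obtain ⟨e, he, hw⟩ := exists_weight_eq hq hqB hu.1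
    exact Finset.mem_image.2 ⟨e, (mem_weightBox hq).2 ⟨he, by omega⟩, hw⟩
  rw [Nat.card_Ico] at h
  omega

end WeightSemigroup

section ArtinSchreierRing

variable {K : Type*} [Field K]

/-- The polynomial `Y ^ q - X ^ s * Y - G`. -/
noncomputable def asPoly (q s : ℕ) (G : K[X]) : K[X][X] := X ^ q - (C (X ^ s) * X + C G)

variable {q s : ℕ} {G : K[X]}

lemma degree_asPoly_tail (hq : 1 < q) : (C (X ^ s) * X + C G : K[X][X]).degree < (q : ℕ) :=
  degree_linear_le.trans_lt (by exact_mod_cast hq)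

lemma monic_asPoly (hq : 1 < q) : (asPoly q s G).Monic :=
  monic_X_pow_sub (degree_asPoly_tail hq)

lemma degree_asPoly (hq : 1 < q) : (asPoly q s G).degree = q := by
  rw [asPoly, degree_sub_eq_left_of_degree_lt] <;> rw [degree_X_pow]
  exact degree_asPoly_tail hq

/-- The monomial `X ^ i * Y ^ j` modulo `Y ^ q - X ^ s * Y - G`. -/
noncomputable def asMonomial (q s : ℕ) (G : K[X]) (e : ℕ × ℕ) : AdjoinRoot (asPoly q s G) :=
  AdjoinRoot.of _ (X ^ e.1) * AdjoinRoot.root _ ^ e.2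

/-- The coefficient of `X ^ i * Y ^ j` in the reduced form of an element. -/
noncomputable def asCoeff (hq : 1 < q) (e : ℕ × ℕ) : AdjoinRoot (asPoly q s G) →ₗ[K] K :=
  (lcoeff K e.1) ∘ₗ ((lcoeff K[X] e.2) ∘ₗ
    AdjoinRoot.modByMonicHom (monic_asPoly (s := s) (G := G) hq)).restrictScalars K

lemma asMonomial_eq_mk (e : ℕ × ℕ) :
    asMonomial q s G e = AdjoinRoot.mk _ (C (X ^ e.1) * X ^ e.2) := by
  simp [asMonomial]

lemma asCoeff_asMonomial (hq : 1 < q) {e : ℕ × ℕ} (he : e.2 < q) (f : ℕ × ℕ) :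
    asCoeff hq f (asMonomial q s G e) = if f = e then 1 else 0 := by
  have h : (AdjoinRoot.modByMonicHom (monic_asPoly (s := s) (G := G) hq))
      (asMonomial q s G e) = C (X ^ e.1) * X ^ e.2 := by
    rw [asMonomial_eq_mk, AdjoinRoot.modByMonicHom_mk,
      (modByMonic_eq_self_iff (monic_asPoly hq)), degree_asPoly hq]
    exact (degree_C_mul_X_pow_le _ _).trans_lt (by exact_mod_cast he)
  simp only [asCoeff, LinearMap.comp_apply, LinearMap.restrictScalars_apply, h, lcoeff_apply,
    coeff_C_mul, coeff_X_pow]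
  rcases e with ⟨i, j⟩
  rcases f with ⟨i', j'⟩
  by_cases hj : j' = j <;> by_cases hi : i' = i <;> simp [hi, hj, coeff_X_pow]

/-- The span of the reduced monomials of weight less than `w`. -/
noncomputable def weightSpan (q s : ℕ) (G : K[X]) (w : ℕ) :
    Submodule K (AdjoinRoot (asPoly q s G)) :=
  Submodule.span K (asMonomial q s G '' {e | e.2 < q ∧ q * e.1 + G.natDegree * e.2 < w})

lemma weightSpan_mono {w w' : ℕ} (h : w ≤ w') : weightSpan q s G w ≤ weightSpan q s G w' :=
  Submodule.span_mono (Set.image_mono fun _ he => ⟨he.1, he.2.trans_le h⟩)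

lemma asCoeff_eq_zero_of_mem (hq : 1 < q) {w : ℕ} {r : AdjoinRoot (asPoly q s G)}
    (hr : r ∈ weightSpan q s G w) {e : ℕ × ℕ} (he : w ≤ q * e.1 + G.natDegree * e.2) :
    asCoeff hq e r = 0 := by
  have : weightSpan q s G w ≤ LinearMap.ker (asCoeff hq e) := by
    rw [weightSpan, Submodule.span_le]
    rintro _ ⟨f, hf, rfl⟩
    simp only [SetLike.mem_coe, LinearMap.mem_ker]
    rw [asCoeff_asMonomial hq hf.1, if_neg]
    rintro rfl
    exact absurd hf.2 (by omega)
  exact this hr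

lemma root_pow_eq : (AdjoinRoot.root (asPoly q s G)) ^ q =
    AdjoinRoot.of _ (X ^ s) * AdjoinRoot.root _ + AdjoinRoot.of _ G := by
  have h : AdjoinRoot.mk (asPoly q s G) (asPoly q s G) = 0 := AdjoinRoot.mk_self
  rw [← sub_eq_zero]
  conv_rhs => rw [← h]
  conv_rhs => arg 2; rw [asPoly]
  simp

lemma asMonomial_add_q (i j : ℕ) : asMonomial q s G (i, j + q) =
    asMonomial q s G (i + s, j + 1) +
      ∑ t ∈ Finset.range (G.natDegree + 1), G.coeff t • asMonomial q s G (i + t, j) := by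
  have hG : AdjoinRoot.of (asPoly q s G) G = ∑ t ∈ Finset.range (G.natDegree + 1),
      G.coeff t • AdjoinRoot.of (asPoly q s G) (X ^ t) := by
    refine (congr_arg (AdjoinRoot.of (asPoly q s G)) G.as_sum_range).trans ?_
    rw [map_sum]
    refine Finset.sum_congr rfl fun t _ => ?_
    rw [← C_mul_X_pow_eq_monomial, map_mul, Algebra.smul_def]
    rfl
  simp only [asMonomial, pow_add, pow_one, map_mul, root_pow_eq, hG, mul_add, Finset.mul_sum]
  refine congr_arg₂ _ (by ring) (Finset.sum_congr rfl fun t _ => ?_)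
  rw [mul_smul_comm, mul_smul_comm]
  ring_nf

/-- Every monomial is, up to a nonzero scalar and terms of lower weight, the reduced monomial of
the same weight. -/
lemma exists_reduction (hq : 1 < q) (hs : q * s < G.natDegree * (q - 1)) (e : ℕ × ℕ) :
    ∃ (f : ℕ × ℕ) (c : K), c ≠ 0 ∧ f.2 < q ∧
      q * f.1 + G.natDegree * f.2 = q * e.1 + G.natDegree * e.2 ∧
      asMonomial q s G e - c • asMonomial q s G f ∈
        weightSpan q s G (q * e.1 + G.natDegree * e.2) := by
  obtain ⟨i, j⟩ := e
  induction j using Nat.strong_induction_on generalizing i with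
  | _ j ih =>
    rcases Nat.lt_or_ge j q with hj | hj
    · exact ⟨(i, j), 1, one_ne_zero, hj, rfl, by simp⟩
    have hlow : ∀ (i' j' w : ℕ), j' < j → q * i' + G.natDegree * j' < w →
        asMonomial q s G (i', j') ∈ weightSpan q s G w := by
      intro i' j' w hj' hw
      obtain ⟨f, c, -, hf, hfw, h⟩ := ih j' hj' i'
      rw [← sub_add_cancel (asMonomial q s G (i', j')) (c • asMonomial q s G f)]
      refine add_mem (weightSpan_mono hw.le h) (Submodule.smul_mem _ _
        (Submodule.subset_span ⟨f, ⟨hf, ?_⟩, rfl⟩))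
      simp only at hfw
      omega
    obtain ⟨j, rfl⟩ : ∃ j', j = j' + q := ⟨j - q, by omega⟩
    obtain ⟨f, c, hc, hf, hfw, h⟩ := ih j (by omega) (i + G.natDegree)
    have hG : G.leadingCoeff ≠ 0 := by
      rw [Ne, leadingCoeff_eq_zero]
      rintro rfl
      simp at hs
    have hw : q * (i + G.natDegree) + G.natDegree * j = q * i + G.natDegree * (j + q) := by ring
    simp only [hw] at hfw h
    refine ⟨f, G.leadingCoeff * c, mul_ne_zero hG hc, hf, hfw, ?_⟩
    rw [asMonomial_add_q, Finset.sum_range_succ, coeff_natDegree, mul_smul]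
    have : ∀ a b d g : AdjoinRoot (asPoly q s G), a + (b + G.leadingCoeff • d) -
        G.leadingCoeff • g = a + b + G.leadingCoeff • (d - g) := by
      intro a b d g
      rw [smul_sub]
      abel
    rw [this]
    refine add_mem (add_mem (hlow _ _ _ (by omega) ?_) (sum_mem fun t ht => ?_))
      (Submodule.smul_mem _ _ h)
    · obtain ⟨q, rfl⟩ : ∃ q', q = q' + 1 := ⟨q - 1, by omega⟩
      simp only [add_tsub_cancel_right] at hs ⊢
      nlinarith
    · refine Submodule.smul_mem _ _ (hlow _ _ _ (by omega) ?_)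
      rw [Finset.mem_range] at ht
      simp only
      nlinarith

lemma asMonomial_mem_weightSpan (hq : 1 < q) (hs : q * s < G.natDegree * (q - 1)) {e : ℕ × ℕ}
    {w : ℕ} (h : q * e.1 + G.natDegree * e.2 < w) :
    asMonomial q s G e ∈ weightSpan q s G w := by
  obtain ⟨f, c, -, hf, hfw, hm⟩ := exists_reduction hq hs e
  rw [← sub_add_cancel (asMonomial q s G e) (c • asMonomial q s G f)]
  exact add_mem (weightSpan_mono h.le hm) (Submodule.smul_mem _ _
    (Submodule.subset_span ⟨f, ⟨hf, by omega⟩, rfl⟩))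

/-- Monomials with pairwise distinct weights are linearly independent. -/
lemma sum_smul_asMonomial_ne_zero (hq : 1 < q) (hs : q * s < G.natDegree * (q - 1))
    {ι : Type*} [Fintype ι] (m : ι → ℕ × ℕ)
    (hm : Function.Injective fun i => q * (m i).1 + G.natDegree * (m i).2)
    (a : ι → K) (ha : ∃ i, a i ≠ 0) : ∑ i, a i • asMonomial q s G (m i) ≠ 0 := by
  classical
  obtain ⟨i₀, hi₀, hmax⟩ := Finset.exists_max_image (Finset.univ.filter fun i => a i ≠ 0)
    (fun i => q * (m i).1 + G.natDegree * (m i).2) (by simpa [Finset.filter_nonempty_iff] using ha)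
  simp only [Finset.mem_filter, Finset.mem_univ, true_and] at hi₀ hmax
  obtain ⟨f, c, hc, hf, hfw, hmem⟩ := exists_reduction hq hs (m i₀)
  intro h0
  have h1 : asCoeff hq f (∑ i, a i • asMonomial q s G (m i)) = a i₀ * c := by
    rw [map_sum, Finset.sum_eq_single i₀]
    · have h2 := asCoeff_eq_zero_of_mem hq hmem hfw.ge
      rw [map_sub, map_smul, asCoeff_asMonomial hq hf, if_pos rfl, sub_eq_zero] at h2
      rw [map_smul, h2, smul_eq_mul, smul_eq_mul, mul_one]
    · intro i _ hi
      by_cases hai : a i = 0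
      · simp [hai]
      have hlt := (hmax i hai).lt_of_ne (fun h => hi (hm h))
      rw [map_smul, asCoeff_eq_zero_of_mem hq (asMonomial_mem_weightSpan hq hs hlt) hfw.ge,
        smul_zero]
    · simp
  rw [h0, map_zero] at h1
  exact mul_ne_zero hi₀ hc h1.symm

/-- Evaluation at a point of the affine curve `Y ^ q = X ^ s * Y + G`. -/
noncomputable def asEval {z y : K} (h : y ^ q = z ^ s * y + G.eval z) :
    AdjoinRoot (asPoly q s G) →+* K :=
  AdjoinRoot.lift (evalRingHom z) y (by simp [asPoly, h, eval₂_pow])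

lemma asEval_asMonomial {z y : K} (h : y ^ q = z ^ s * y + G.eval z) (e : ℕ × ℕ) :
    asEval h (asMonomial q s G e) = z ^ e.1 * y ^ e.2 := by
  simp [asEval, asMonomial]

lemma asEval_smul {z y : K} (h : y ^ q = z ^ s * y + G.eval z) (a : K)
    (r : AdjoinRoot (asPoly q s G)) : asEval h (a • r) = a * asEval h r := by
  rw [Algebra.smul_def, map_mul]
  congr 1
  rw [AdjoinRoot.algebraMap_eq']
  simp [asEval]

end ArtinSchreierRing

section Stepanov

variable {K : Type*} [Field K] {q s : ℕ} {G : K[X]}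

lemma card_roots_curve [IsAlgClosed K] (hq : 1 < q) (hqK : (q : K) = 0) {z : K} (hz : z ≠ 0) :
    ∃ S : Finset K, S.card = q ∧ ∀ y ∈ S, y ^ q = z ^ s * y + G.eval z := by
  classical
  have hdeg : (C (z ^ s) * X + C (G.eval z) : K[X]).degree < (q : ℕ) :=
    degree_linear_le.trans_lt (by exact_mod_cast hq)
  set f : K[X] := X ^ q - (C (z ^ s) * X + C (G.eval z)) with hf
  have hmonic : f.Monic := monic_X_pow_sub hdeg
  have hsep : f.Separable := by
    rw [separable_def']
    refine ⟨0, C (-(z ^ s)⁻¹), ?_⟩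
    have : derivative f = C (-(z ^ s)) := by
      simp [hf, derivative_pow, hqK]
    rw [this, zero_mul, zero_add, ← C_mul, neg_mul_neg, inv_mul_cancel₀ (pow_ne_zero _ hz), C_1]
  refine ⟨f.roots.toFinset, ?_, fun y hy => ?_⟩
  · rw [Multiset.toFinset_card_of_nodup (nodup_roots hsep),
      ← (IsAlgClosed.splits f).natDegree_eq_card_roots]
    refine natDegree_eq_of_degree_eq_some ?_
    rw [hf, degree_sub_eq_left_of_degree_lt] <;> rw [degree_X_pow]
    exact hdeg
  · rw [Multiset.mem_toFinset, mem_roots hmonic.ne_zero, IsRoot.def] at hy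
    simpa [hf, sub_eq_zero] using hy

/-- A nonzero element of bounded weight vanishes over few values of `X`. -/
lemma card_le_of_vanishing [IsAlgClosed K] (hq : 1 < q) (hqK : (q : K) = 0) {w : ℕ}
    {v : AdjoinRoot (asPoly q s G)} (hv : v ≠ 0) (hw : v ∈ weightSpan q s G w) {A : Finset K}
    (hA0 : ∀ z ∈ A, z ≠ 0)
    (hA : ∀ z ∈ A, ∀ (y : K) (h : y ^ q = z ^ s * y + G.eval z), asEval h v = 0) :
    q * A.card < w := by
  set f := AdjoinRoot.modByMonicHom (monic_asPoly (s := s) (G := G) hq) v with hf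
  have hmk : AdjoinRoot.mk _ f = v := AdjoinRoot.mk_leftInverse (monic_asPoly hq) v
  have hdeg : f.degree < (q : ℕ) := by
    obtain ⟨g, rfl⟩ := AdjoinRoot.mk_surjective v
    rw [hf, AdjoinRoot.modByMonicHom_mk, ← degree_asPoly (s := s) (G := G) hq]
    exact degree_modByMonic_lt _ (monic_asPoly hq)
  have hf0 : f ≠ 0 := by
    intro h
    rw [h, map_zero] at hmk
    exact hv hmk.symm
  obtain ⟨j, hj⟩ : ∃ j, f.coeff j ≠ 0 := by
    by_contra! h
    exact hf0 (Polynomial.ext h)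
  have hroot : ∀ z ∈ A, (f.coeff j).eval z = 0 := by
    intro z hz
    obtain ⟨S, hS, hSy⟩ := card_roots_curve (s := s) (G := G) hq hqK (hA0 z hz)
    have h0 : f.map (evalRingHom z) = 0 := by
      refine eq_zero_of_degree_lt_of_eval_finset_eq_zero S ?_ fun y hy => ?_
      · rw [hS]
        exact degree_map_le.trans_lt hdeg
      · have := hA z hz y (hSy y hy)
        rw [← hmk] at this
        simpa [asEval, eval_map] using this
    have := congr_arg (fun g => g.coeff j) h0
    simpa using this
  have hcard : A.card ≤ (f.coeff j).natDegree :=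
    card_le_degree_of_subset_roots fun z hz => by
      rw [mem_roots hj]
      exact hroot z hz
  by_contra! hlt
  have h1 : asCoeff hq ((f.coeff j).natDegree, j) v = 0 := by
    refine asCoeff_eq_zero_of_mem hq hw (hlt.trans ?_)
    have := Nat.mul_le_mul_left q hcard
    simp only
    omega
  exact hj (leadingCoeff_eq_zero.1 h1)

/-- The Stepanov–Bombieri estimate for the curve `Y ^ q = X ^ s * Y + G`. -/
theorem card_le_of_curve [IsAlgClosed K] {p : ℕ} [Fact p.Prime] [CharP K p] {P n : ℕ}
    (hP : P = p ^ n) (hq : 1 < q) (hqK : (q : K) = 0) (hqG : q.Coprime G.natDegree)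
    (hs : q * s < G.natDegree * (q - 1))
    (hlarge : (q * G.natDegree) ^ 2 + 3 * (q * G.natDegree) + 1 < P) {A : Finset K}
    (hA0 : ∀ z ∈ A, z ≠ 0) (hA : ∀ z ∈ A, z ^ (P * P) = z)
    (hAy : ∀ z ∈ A, ∀ y : K, y ^ q = z ^ s * y + G.eval z → y ^ (P * P) = y) :
    q * A.card < P + (P + 2 * (q * G.natDegree)) * P := by
  set B := G.natDegree with hB
  set g := q * B with hg
  have hq0 : 0 < q := by omega
  have hP0 : 0 < P := by omega
  let E := weightBox q B (P - 1)
  let S := weightBox q B (P + 2 * g)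
  have hE : ∀ e : E, e.1.2 < q ∧ q * e.1.1 + B * e.1.2 < P := fun e =>
    ⟨((mem_weightBox hq0).1 e.2).1, by have := ((mem_weightBox hq0).1 e.2).2; omega⟩
  have hS : ∀ e : S, e.1.2 < q ∧ q * e.1.1 + B * e.1.2 ≤ P + 2 * g := fun e =>
    (mem_weightBox hq0).1 e.2
  let T : Set (ℕ × ℕ) :=
    {e | e.2 < q ∧ q * e.1 + B * e.2 < P * (P - 1) + (P + 2 * g) + 1}
  have hT : T = ↑(weightBox q B (P * (P - 1) + (P + 2 * g))) := by
    ext e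
    rw [Finset.mem_coe, mem_weightBox hq0, Set.mem_ofPred_eq, Nat.lt_succ_iff]
  have hdep : ¬ LinearIndependent K
      (fun i : E × S => asMonomial q s G (P • i.1.1 + i.2.1)) := by
    intro hli
    have hmem : ∀ i : E × S, asMonomial q s G (P • i.1.1 + i.2.1) ∈
        weightSpan q s G (P * (P - 1) + (P + 2 * g) + 1) := by
      intro i
      refine asMonomial_mem_weightSpan hq hs ?_
      have h1 := (hE i.1).2
      have h2 := (hS i.2).2
      simp only [Prod.fst_add, Prod.snd_add, Prod.smul_fst, Prod.smul_snd, smul_eq_mul]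
      have h3 := Nat.mul_le_mul_left P (Nat.le_sub_one_of_lt h1)
      nlinarith
    have hfin : T.Finite := hT ▸ Finset.finite_toSet _
    have : Module.Finite K (weightSpan q s G (P * (P - 1) + (P + 2 * g) + 1)) :=
      Module.Finite.span_of_finite K (hfin.image _)
    have hli' := LinearIndependent.fintype_card_le_finrank
      (LinearIndependent.of_comp (v := fun i : E × S => (⟨_, hmem i⟩ :
        weightSpan q s G (P * (P - 1) + (P + 2 * g) + 1))) (Submodule.subtype _) hli)
    rw [Fintype.card_prod, Fintype.card_coe, Fintype.card_coe] at hli'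
    have hrank : Module.finrank K (weightSpan q s G (P * (P - 1) + (P + 2 * g) + 1)) ≤
        P * (P - 1) + (P + 2 * g) + 1 := by
      classical
      have h1 := finrank_span_finset_le_card (R := K)
        ((weightBox q B (P * (P - 1) + (P + 2 * g))).image (asMonomial q s G))
      rw [Finset.coe_image, ← hT] at h1
      exact h1.trans (Finset.card_image_le.trans (card_weightBox_le hq0 hqG _))
    have h1 := le_card_weightBox hq0 hqG (P - 1)
    have h2 := le_card_weightBox hq0 hqG (P + 2 * g)
    have h3 : P - g ≤ E.card := by simp only [E]; omega
    have h4 : P + g + 1 ≤ S.card := by simp only [S]; omega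
    have h5 := (Nat.mul_le_mul h3 h4).trans (hli'.trans hrank)
    obtain ⟨P', rfl⟩ : ∃ P', P = P' + g + 1 := ⟨P - g - 1, by
      have := Nat.le_self_pow (n := 2) (by norm_num) g
      omega⟩
    rw [show P' + g + 1 - g = P' + 1 by omega, show P' + g + 1 - 1 = P' + g by omega] at h5
    nlinarith
  rw [Fintype.not_linearIndependent_iff] at hdep
  obtain ⟨c, hc, i₀, hi₀⟩ := hdep
  choose a ha using fun i => IsAlgClosed.exists_pow_nat_eq (c i) hP0
  let v := ∑ i, a i • asMonomial q s G (i.1.1 + P • i.2.1)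
  have hv0 : v ≠ 0 := by
    refine sum_smul_asMonomial_ne_zero hq hs _ ?_ _ ⟨i₀, ?_⟩
    · rintro ⟨e, f⟩ ⟨e', f'⟩ h
      simp only [Prod.fst_add, Prod.snd_add, Prod.smul_fst, Prod.smul_snd, smul_eq_mul] at h
      have h' : (q * e.1.1 + B * e.1.2) + P * (q * f.1.1 + B * f.1.2) =
          (q * e'.1.1 + B * e'.1.2) + P * (q * f'.1.1 + B * f'.1.2) := by
        linear_combination h
      have h1 : q * e.1.1 + B * e.1.2 = q * e'.1.1 + B * e'.1.2 := by
        have := congr_arg (· % P) h'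
        simpa [Nat.mod_eq_of_lt (hE e).2, Nat.mod_eq_of_lt (hE e').2] using this
      have h2 : q * f.1.1 + B * f.1.2 = q * f'.1.1 + B * f'.1.2 := by
        rw [h1] at h'
        exact Nat.eq_of_mul_eq_mul_left hP0 (by omega)
      exact Prod.ext (Subtype.ext (weight_injOn hqG (hE e).1 (hE e').1 h1))
        (Subtype.ext (weight_injOn hqG (hS f).1 (hS f').1 h2))
    · rintro h
      rw [← ha, h, zero_pow hP0.ne'] at hi₀
      exact hi₀ rfl
  refine card_le_of_vanishing hq hqK (v := v) hv0 (sum_mem fun i _ => Submodule.smul_mem _ _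
    (asMonomial_mem_weightSpan hq hs ?_)) hA0 fun z hz y h => ?_
  · have h1 := (hE i.1).2
    have h2 := Nat.mul_le_mul_left P (hS i.2).2
    simp only [Prod.fst_add, Prod.snd_add, Prod.smul_fst, Prod.smul_snd, smul_eq_mul]
    nlinarith
  · have h0 := congr_arg (asEval h) hc
    simp only [map_sum, asEval_smul, asEval_asMonomial, map_zero] at h0
    simp only [v, map_sum, asEval_smul, asEval_asMonomial]
    refine eq_zero_of_pow_eq_zero (n := P) ?_
    have := ExpChar.prime (R := K) (Fact.out : p.Prime)
    rw [hP, sum_pow_char_pow, ← hP, ← h0]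
    refine Finset.sum_congr rfl fun i _ => ?_
    have hz' := hA z hz
    have hy' := hAy z hz y h
    simp only [Prod.fst_add, Prod.snd_add, Prod.smul_fst, Prod.smul_snd, smul_eq_mul]
    rw [mul_pow, ha, mul_pow, ← pow_mul, ← pow_mul, add_mul, add_mul, pow_add, pow_add,
      pow_add, pow_add, mul_right_comm P, pow_mul z (P * P), hz', mul_right_comm P,
      pow_mul y (P * P), hy', mul_comm P, mul_comm P]

end Stepanov

section FrobSum

variable {K : Type*} [Field K]

/-- The sum `u + u ^ q + ⋯ + u ^ (q ^ (N - 1))`. -/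
def frobSum (q N : ℕ) (u : K) : K := ∑ i ∈ Finset.range N, u ^ q ^ i

variable {p e q : ℕ} [Fact p.Prime] [CharP K p]

lemma frobSum_sub (hq : q = p ^ e) (N : ℕ) (u v : K) :
    frobSum q N (u - v) = frobSum q N u - frobSum q N v := by
  have := ExpChar.prime (R := K) (Fact.out : p.Prime)
  simp only [frobSum, ← Finset.sum_sub_distrib, hq, ← pow_mul, sub_pow_expChar_pow]

lemma frobSum_pow_sub_self (hq : q = p ^ e) (N : ℕ) (y : K) :
    frobSum q N (y ^ q - y) = y ^ q ^ N - y := by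
  rw [frobSum_sub hq]
  simp only [frobSum, ← pow_mul, ← pow_succ']
  rw [← Finset.sum_sub_distrib, Finset.sum_range_sub (fun i => y ^ q ^ i), pow_zero, pow_one]

lemma exists_frobSum_eq [IsAlgClosed K] (hq : (q : K) = 0) {N : ℕ} (hN : 0 < N) (c : K) :
    ∃ u, frobSum q N u = c := by
  obtain ⟨n, rfl⟩ : ∃ n, N = n + 1 := ⟨N - 1, by omega⟩
  set f : K[X] := ∑ i ∈ Finset.range (n + 1), X ^ q ^ i - C c with hf
  have hder : derivative f = 1 := by
    rw [hf, derivative_sub, derivative_C, sub_zero, derivative_sum, Finset.sum_range_succ']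
    rw [Finset.sum_eq_zero fun i _ => ?_]
    · simp
    · simp [derivative_X_pow, hq]
  have hdeg : f.degree ≠ 0 := by
    intro h
    rw [eq_C_of_degree_eq_zero h, derivative_C] at hder
    exact zero_ne_one hder
  obtain ⟨u, hu⟩ := IsAlgClosed.exists_root f hdeg
  refine ⟨u, ?_⟩
  simpa [hf, frobSum, IsRoot.def, eval_finsetSum, sub_eq_zero] using hu

end FrobSum

section PointCount

variable {K : Type*} [Field K]

/-- The Laurent polynomial function `∑ tᵢ x ^ bᵢ`. -/
def laurentEval {k : ℕ} (b : Fin k → ℤ) (t : Fin k → K) (x : K) : K := ∑ i, t i * x ^ b i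

/-- The polynomial `X ^ (M q) * (∑ tᵢ X ^ ((q - 1) bᵢ) - c)`. -/
noncomputable def clearedPoly {k : ℕ} (q M : ℕ) (b : Fin k → ℤ) (t : Fin k → K) (c : K) : K[X] :=
  ∑ i, C (t i) * X ^ ((M * q + (q - 1) * b i : ℤ).toNat) - C c * X ^ (M * q)

variable {k : ℕ} {b : Fin k → ℤ} {t : Fin k → K} {q M : ℕ}

lemma laurentEval_inv (x : K) :
    laurentEval (fun i => -b i) t x⁻¹ = laurentEval b t x := by
  simp [laurentEval]

lemma exponent_nonneg (hq : 1 < q) (hM : ∀ i, 0 ≤ (M : ℤ) + b i) (i : Fin k) :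
    0 ≤ (M * q + (q - 1) * b i : ℤ) := by
  have := hM i
  have h2 : (1 : ℤ) < q := by exact_mod_cast hq
  nlinarith

lemma eval_clearedPoly (hq : 1 < q) (hM : ∀ i, 0 ≤ (M : ℤ) + b i) (c : K) {z : K} (hz : z ≠ 0) :
    (clearedPoly q M b t c).eval z =
      z ^ (M * q) * (laurentEval b t (z ^ (q - 1)) - c) := by
  simp only [clearedPoly, laurentEval, eval_sub, eval_finsetSum, eval_mul, eval_C, eval_pow, eval_X,
    mul_sub, Finset.mul_sum]
  refine congr_arg₂ _ (Finset.sum_congr rfl fun i _ => ?_) (mul_comm _ _)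
  rw [← zpow_natCast z (Int.toNat _), Int.toNat_of_nonneg (exponent_nonneg hq hM i),
    zpow_add₀ hz, zpow_mul, zpow_mul, zpow_natCast, zpow_natCast, ← pow_mul,
    show (q - 1 : ℤ) = (q - 1 : ℕ) by push_cast [hq.le]; rfl, zpow_natCast]
  ring

lemma natDegree_clearedPoly (hq : 1 < q) (hM : ∀ i, 0 ≤ (M : ℤ) + b i) (hb : b.Injective)
    {i₀ : Fin k} (hi₀ : 0 < b i₀) (ht₀ : t i₀ ≠ 0) (hmax : ∀ i, t i ≠ 0 → b i ≤ b i₀) (c : K) :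
    ((clearedPoly q M b t c).natDegree : ℤ) = M * q + (q - 1) * b i₀ := by
  have h2 : (1 : ℤ) < q := by exact_mod_cast hq
  have hexp := exponent_nonneg (b := b) hq hM
  suffices h : (clearedPoly q M b t c).natDegree = (M * q + (q - 1) * b i₀ : ℤ).toNat by
    rw [h, Int.toNat_of_nonneg (hexp i₀)]
  have hlt : M * q < (M * q + (q - 1) * b i₀ : ℤ).toNat := by
    zify
    rw [Int.toNat_of_nonneg (hexp i₀)]
    nlinarith
  refine natDegree_eq_of_le_of_coeff_ne_zero ?_ ?_
  · refine (natDegree_sub_le _ _).trans (max_le ?_ ?_)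
    · refine natDegree_sum_le_of_forall_le _ _ fun i _ => ?_
      by_cases h : t i = 0
      · simp [h]
      refine (natDegree_C_mul_X_pow_le _ _).trans (Int.toNat_le_toNat ?_)
      have := hmax i h
      nlinarith
    · exact (natDegree_C_mul_X_pow_le _ _).trans hlt.le
  · rw [clearedPoly, coeff_sub, finsetSum_coeff, coeff_C_mul_X_pow, if_neg hlt.ne', sub_zero,
      Finset.sum_eq_single i₀]
    · simpa [coeff_C_mul_X_pow] using ht₀
    · intro i _ hi
      rw [coeff_C_mul_X_pow, if_neg]
      intro h
      apply hi
      apply hb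
      zify at h
      rw [Int.toNat_of_nonneg (hexp i₀), Int.toNat_of_nonneg (hexp i)] at h
      exact (mul_left_cancel₀ (by omega) (add_left_cancel h)).symm
    · simp

/-- Upper bound for the number of points with prescribed trace. -/
lemma exists_card_le_of_pos [IsAlgClosed K] {p e : ℕ} [Fact p.Prime] [CharP K p] (hqp : q = p ^ e)
    (hq : 1 < q) (hb : b.Injective) (hbp : ∀ i, ¬ (p : ℤ) ∣ b i) {i₀ : Fin k} (hi₀ : 0 < b i₀)
    (ht₀ : t i₀ ≠ 0) (hmax : ∀ i, t i ≠ 0 → b i ≤ b i₀) :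
    ∃ C α₀ : ℕ, ∀ α ≥ α₀, ∀ (c : K) (A : Finset K), (∀ z ∈ A, z ≠ 0 ∧ z ^ q ^ (2 * α) = z ∧
      frobSum q (2 * α) (laurentEval b t (z ^ (q - 1))) = c) →
      q * A.card ≤ q ^ (2 * α) + C * q ^ α := by
  have hp : p.Prime := Fact.out
  have he : e ≠ 0 := by
    rintro rfl
    simp [hqp] at hq
  have hpq : p ∣ q := hqp ▸ dvd_pow_self p he
  have hqK : (q : K) = 0 := (CharP.cast_eq_zero_iff K p q).2 hpq
  have h2 : (1 : ℤ) < q := by exact_mod_cast hq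
  obtain ⟨M, hM⟩ : ∃ M : ℕ, ∀ i, 0 ≤ (M : ℤ) + b i := by
    refine ⟨∑ i, (b i).natAbs, fun i => ?_⟩
    have := Finset.single_le_sum (f := fun i => (b i).natAbs) (fun _ _ => Nat.zero_le _)
      (Finset.mem_univ i)
    omega
  obtain ⟨B, hB⟩ : ∃ B : ℕ, (B : ℤ) = M * q + (q - 1) * b i₀ :=
    ⟨_, Int.toNat_of_nonneg (exponent_nonneg hq hM i₀)⟩
  have hqB : q.Coprime B := by
    rw [hqp]
    refine Nat.Coprime.pow_left e ((Nat.Prime.coprime_iff_not_dvd hp).2 fun h => hbp i₀ ?_)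
    have h3 : (p : ℤ) ∣ B := by exact_mod_cast h
    have h4 : (p : ℤ) ∣ q := by exact_mod_cast hpq
    rw [show b i₀ = q * (M + b i₀) - B by rw [hB]; ring]
    exact dvd_sub (h4.mul_right _) h3
  have hs : q * (M * (q - 1)) < B * (q - 1) := by
    rw [← mul_assoc]
    refine Nat.mul_lt_mul_of_pos_right ?_ (by omega)
    zify
    rw [hB]
    nlinarith
  refine ⟨1 + 2 * (q * B), (q * B) ^ 2 + 3 * (q * B) + 2, fun α hα c A hA => ?_⟩
  obtain ⟨c', hc'⟩ := exists_frobSum_eq hqK (N := 2 * α) (by omega) c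
  set G := clearedPoly q M b t c'
  have hG : G.natDegree = B := by
    have := natDegree_clearedPoly hq hM hb hi₀ ht₀ hmax c'
    rw [← hB] at this
    exact_mod_cast this
  have hQ : q ^ α * q ^ α = q ^ (2 * α) := by rw [← pow_add, two_mul]
  have key := card_le_of_curve (K := K) (p := p) (P := q ^ α) (n := e * α) (q := q)
    (s := M * (q - 1)) (G := G) (A := A) (by rw [hqp, pow_mul]) hq hqK (by rwa [hG])
    (by rwa [hG]) (by
      rw [hG]
      have := Nat.lt_pow_self hq (n := α)
      omega) (fun z hz => (hA z hz).1) (fun z hz => by rw [hQ]; exact (hA z hz).2.1) ?_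
  · rw [hG] at key
    rw [← hQ]
    nlinarith
  · intro z hz y hy
    obtain ⟨hz0, hzQ, hzc⟩ := hA z hz
    rw [hQ]
    rw [eval_clearedPoly hq hM c' hz0] at hy
    obtain ⟨u, rfl⟩ : ∃ u, y = z ^ M * u :=
      ⟨y / z ^ M, by rw [mul_div_cancel₀ _ (pow_ne_zero _ hz0)]⟩
    have h5 : M * (q - 1) + M = M * q := by
      obtain ⟨r, rfl⟩ : ∃ r, q = r + 1 := ⟨q - 1, by omega⟩
      simp
      ring
    rw [mul_pow, ← mul_assoc, ← pow_add, h5, ← pow_mul, ← mul_add] at hy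
    have hu : u ^ q - u = laurentEval b t (z ^ (q - 1)) - c' := by
      rw [mul_left_cancel₀ (pow_ne_zero _ hz0) hy]
      ring
    have h6 := frobSum_pow_sub_self (K := K) hqp (2 * α) u
    rw [hu, frobSum_sub hqp, hzc, hc', sub_self, eq_comm, sub_eq_zero] at h6
    rw [mul_pow, h6, ← pow_mul, mul_comm M, pow_mul, hzQ]

end PointCount

section CyclicUnits

variable {F K : Type*} [Field F] [Fintype F] [Field K]

/-- The nonzero elements `z` with `z ^ (q ^ N) = z`. -/
noncomputable def cyclicUnits (F K : Type*) [Field F] [Fintype F] [Field K] (N : ℕ) : Finset K :=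
  nthRootsFinset (Fintype.card F ^ N - 1) 1

lemma mem_cyclicUnits {N : ℕ} (hN : 0 < N) {z : K} :
    z ∈ cyclicUnits F K N ↔ z ≠ 0 ∧ z ^ Fintype.card F ^ N = z := by
  have h1 : 1 < Fintype.card F ^ N := Nat.one_lt_pow hN.ne' Fintype.one_lt_card
  rw [cyclicUnits, mem_nthRootsFinset (by omega)]
  constructor
  · intro h
    refine ⟨fun h0 => ?_, ?_⟩
    · rw [h0, zero_pow (by omega)] at h
      exact zero_ne_one h
    · rw [← Nat.sub_add_cancel h1.le, pow_succ, h, one_mul]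
  · rintro ⟨h0, h⟩
    refine mul_right_cancel₀ h0 ?_
    rw [← pow_succ, Nat.sub_add_cancel h1.le, h, one_mul]

end CyclicUnits

section FiniteSubfield

variable {F K : Type*} [Field F] [Fintype F] [Field K] [Algebra F K]

lemma exists_algebraMap_eq {u : K} (h : u ^ Fintype.card F = u) :
    ∃ a : F, algebraMap F K a = u := by
  have h1 : (X ^ Fintype.card F - X : F[X]).Splits := by
    rw [splits_iff_card_roots, FiniteField.roots_X_pow_card_sub_X,
      FiniteField.X_pow_card_sub_X_natDegree_eq F Fintype.one_lt_card]
    rfl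
  exact h1.mem_range_of_isRoot (FiniteField.X_pow_card_sub_X_ne_zero F Fintype.one_lt_card)
    (by simp [h])

lemma card_nthRootsFinset_of_isAlgClosed [IsAlgClosed K] {n : ℕ} (hn : (n : K) ≠ 0) {a : K}
    (ha : a ≠ 0) : (nthRootsFinset n a).card = n := by
  classical
  have h := separable_X_pow_sub_C a hn ha
  rw [nthRootsFinset_def, Multiset.toFinset_card_of_nodup (by exact nodup_roots h), nthRoots,
    ← (IsAlgClosed.splits _).natDegree_eq_card_roots, natDegree_X_pow_sub_C]

lemma card_sub_one_cast_ne_zero {N : ℕ} (hN : 0 < N) :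
    ((Fintype.card F ^ N - 1 : ℕ) : K) ≠ 0 := by
  have h : ((Fintype.card F : ℕ) : K) = 0 := by
    rw [← map_natCast (algebraMap F K), FiniteField.cast_card_eq_zero, map_zero]
  rw [Nat.cast_sub (Nat.one_le_pow _ _ Fintype.card_pos), Nat.cast_pow, h, zero_pow hN.ne']
  simp

lemma card_cyclicUnits [IsAlgClosed K] {N : ℕ} (hN : 0 < N) :
    (cyclicUnits F K N).card = Fintype.card F ^ N - 1 :=
  card_nthRootsFinset_of_isAlgClosed (card_sub_one_cast_ne_zero (F := F) hN) one_ne_zero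

lemma frobSum_mem_range [CharP K (ringChar F)] {N : ℕ} {u : K} (hu : u ^ Fintype.card F ^ N = u) :
    ∃ a : F, algebraMap F K a = frobSum (Fintype.card F) N u := by
  have : Fact (ringChar F).Prime := ⟨CharP.char_is_prime F _⟩
  have := ExpChar.prime (R := K) (Fact.out : (ringChar F).Prime)
  obtain ⟨e, -, he⟩ := FiniteField.card F (ringChar F)
  refine exists_algebraMap_eq ?_
  conv_lhs => arg 2; rw [he]
  rw [frobSum, sum_pow_char_pow, ← he]
  simp only [← pow_mul, ← pow_succ]
  have h := Finset.sum_range_succ' (fun i => u ^ Fintype.card F ^ i) N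
  rw [Finset.sum_range_succ, hu, pow_zero, pow_one] at h
  exact (add_right_cancel h).symm

end FiniteSubfield

section PointCountBound

variable {F K : Type*} [Field F] [Fintype F] [Field K] [Algebra F K]
  {p k : ℕ} {b : Fin k → ℤ} {t : Fin k → F}

lemma laurentEval_pow_card_pow [Fact p.Prime] [CharP K p] {e : ℕ} (hq : Fintype.card F = p ^ e)
    (x : K) (N : ℕ) : laurentEval b (algebraMap F K ∘ t) x ^ Fintype.card F ^ N =
      laurentEval b (algebraMap F K ∘ t) (x ^ Fintype.card F ^ N) := by
  have := ExpChar.prime (R := K) (Fact.out : p.Prime)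
  rw [laurentEval]
  conv_lhs => arg 2; rw [hq]
  rw [← pow_mul, sum_pow_char_pow, pow_mul, ← hq]
  refine Finset.sum_congr rfl fun i _ => ?_
  rw [mul_pow, Function.comp_apply, ← map_pow, FiniteField.pow_card_pow, ← zpow_natCast,
    ← zpow_natCast, ← zpow_mul, ← zpow_mul, mul_comm (b i)]

/-- The points of the torus with given trace. -/
noncomputable def traceFiber [DecidableEq K] (F : Type*) [Field F] [Fintype F] {k : ℕ}
    (b : Fin k → ℤ) (t : Fin k → K) (N : ℕ) (c : K) : Finset K :=
  (cyclicUnits F K N).filter fun z =>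
    frobSum (Fintype.card F) N (laurentEval b t (z ^ (Fintype.card F - 1))) = c

variable [IsAlgClosed K]

lemma exists_card_traceFiber_le [DecidableEq K] [Fact p.Prime] [CharP F p] [CharP K p]
    (hb : b.Injective) (hbp : ∀ i, ¬ (p : ℤ) ∣ b i) (ht : t ≠ 0) :
    ∃ C α₀ : ℕ, ∀ α ≥ α₀, ∀ c : K,
      Fintype.card F * (traceFiber F b (algebraMap F K ∘ t) (2 * α) c).card ≤
        Fintype.card F ^ (2 * α) + C * Fintype.card F ^ α := by
  classical
  obtain ⟨e, -, he⟩ := FiniteField.card F p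
  have hs : (Finset.univ.filter fun i => t i ≠ 0).Nonempty := by
    obtain ⟨i, hi⟩ := Function.ne_iff.1 ht
    exact ⟨i, by simpa using hi⟩
  obtain ⟨i₀, hi₀, hmax⟩ := Finset.exists_max_image _ b hs
  simp only [Finset.mem_filter, Finset.mem_univ, true_and] at hi₀ hmax
  have hne : ∀ i : Fin k, b i ≠ 0 := fun i h => hbp i (h ▸ dvd_zero _)
  have hmem : ∀ {α : ℕ}, 1 ≤ α → ∀ {c z : K},
      z ∈ traceFiber F b (algebraMap F K ∘ t) (2 * α) c ↔ (z ≠ 0 ∧ z ^ Fintype.card F ^ (2 * α) = z)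
      ∧ frobSum (Fintype.card F) (2 * α)
        (laurentEval b (algebraMap F K ∘ t) (z ^ (Fintype.card F - 1))) = c := by
    intro α hα c z
    rw [traceFiber, Finset.mem_filter, mem_cyclicUnits (by omega)]
  rcases (hne i₀).lt_or_gt with hneg | hpos
  · obtain ⟨i₁, hi₁, hmin⟩ := Finset.exists_min_image _ b hs
    simp only [Finset.mem_filter, Finset.mem_univ, true_and] at hi₁ hmin
    obtain ⟨C, α₀, h⟩ := exists_card_le_of_pos (K := K) (b := fun i => -b i)
      (t := algebraMap F K ∘ t) he Fintype.one_lt_card (fun i j hij => hb (neg_injective hij))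
      (fun i => by rw [dvd_neg]; exact hbp i) (i₀ := i₁)
      (by have := hmax i₁ hi₁; omega) (by simpa using hi₁)
      (fun i hi => neg_le_neg (hmin i (by simpa using hi)))
    refine ⟨C, max α₀ 1, fun α hα c => ?_⟩
    rw [← Finset.card_image_of_injective _ inv_injective]
    refine h α (le_of_max_le_left hα) c _ fun z hz => ?_
    obtain ⟨y, hy, rfl⟩ := Finset.mem_image.1 hz
    rw [hmem (le_of_max_le_right hα)] at hy
    refine ⟨inv_ne_zero hy.1.1, ?_, ?_⟩
    · rw [inv_pow, hy.1.2]
    · rw [inv_pow, laurentEval_inv, hy.2]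
  · obtain ⟨C, α₀, h⟩ := exists_card_le_of_pos (K := K) (b := b)
      (t := algebraMap F K ∘ t) he Fintype.one_lt_card hb hbp (i₀ := i₀)
      hpos (by simpa using hi₀) (fun i hi => hmax i (by simpa using hi))
    refine ⟨C, max α₀ 1, fun α hα c => h α (le_of_max_le_left hα) c _ fun z hz => ?_⟩
    rw [hmem (le_of_max_le_right hα)] at hz
    exact ⟨hz.1.1, hz.1.2, hz.2⟩

/-- The square-root estimate for the number of points with trace zero. -/
theorem exists_abs_card_traceFiber_le [DecidableEq K] [Fact p.Prime] [CharP F p] [CharP K p]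
    (hb : b.Injective) (hbp : ∀ i, ¬ (p : ℤ) ∣ b i) (ht : t ≠ 0) :
    ∃ (C : ℝ) (α₀ : ℕ), ∀ α ≥ α₀,
      |(Fintype.card F : ℝ) * (traceFiber F b (algebraMap F K ∘ t) (2 * α) 0).card -
        ((Fintype.card F : ℝ) ^ (2 * α) - 1)| ≤ C * (Fintype.card F : ℝ) ^ α := by
  classical
  obtain ⟨C, α₀, h⟩ := exists_card_traceFiber_le (K := K) hb hbp ht
  obtain ⟨e, -, he⟩ := FiniteField.card F p
  obtain rfl : p = ringChar F := (ringChar.eq F p).symm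
  set q := Fintype.card F with hq
  have hq1 : 1 < q := Fintype.one_lt_card
  refine ⟨C * q + q, max α₀ 1, fun α hα => ?_⟩
  have hα1 : 1 ≤ α := le_of_max_le_right hα
  have hsum : ∑ c : F, (traceFiber F b (algebraMap F K ∘ t) (2 * α) (algebraMap F K c)).card =
      q ^ (2 * α) - 1 := by
    rw [← card_cyclicUnits (F := F) (K := K) (N := 2 * α) (by omega)]
    have hmaps : ∀ z ∈ cyclicUnits F K (2 * α), frobSum q (2 * α)
        (laurentEval b (algebraMap F K ∘ t) (z ^ (q - 1))) ∈
          Finset.univ.image (algebraMap F K) := by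
      intro z hz
      rw [mem_cyclicUnits (by omega)] at hz
      obtain ⟨a, ha⟩ := frobSum_mem_range (F := F) (N := 2 * α)
        (u := laurentEval b (algebraMap F K ∘ t) (z ^ (q - 1))) (by
          rw [laurentEval_pow_card_pow he, ← pow_mul, mul_comm, pow_mul, hz.2])
      exact Finset.mem_image.2 ⟨a, Finset.mem_univ _, ha⟩
    rw [Finset.card_eq_sum_card_fiberwise hmaps,
      Finset.sum_image fun _ _ _ _ h => (algebraMap F K).injective h]
    rfl
  have hle : ∀ c : K, (q : ℝ) * (traceFiber F b (algebraMap F K ∘ t) (2 * α) c).card ≤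
      (q : ℝ) ^ (2 * α) + C * (q : ℝ) ^ α := fun c => by
    exact_mod_cast h α (le_of_max_le_left hα) c
  have hsum' : ∑ c : F,
      ((traceFiber F b (algebraMap F K ∘ t) (2 * α) (algebraMap F K c)).card : ℝ) =
      (q : ℝ) ^ (2 * α) - 1 := by
    have h1 : 1 ≤ q ^ (2 * α) := Nat.one_le_pow _ _ (by omega)
    rw [← Nat.cast_sum, hsum, Nat.cast_sub h1]
    push_cast
    rfl
  rw [← Finset.add_sum_erase _ _ (Finset.mem_univ (0 : F)), map_zero] at hsum'
  have hrest : (q : ℝ) * ∑ c ∈ Finset.univ.erase (0 : F),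
      ((traceFiber F b (algebraMap F K ∘ t) (2 * α) (algebraMap F K c)).card : ℝ) ≤
      (q - 1) * ((q : ℝ) ^ (2 * α) + C * (q : ℝ) ^ α) := by
    rw [Finset.mul_sum]
    refine (Finset.sum_le_card_nsmul _ _ _ fun c _ => hle _).trans_eq ?_
    rw [Finset.card_erase_of_mem (Finset.mem_univ _), Finset.card_univ, nsmul_eq_mul, ← hq,
      Nat.cast_sub hq1.le, Nat.cast_one]
  have hqr : (1 : ℝ) < q := by exact_mod_cast hq1
  have hqα : (1 : ℝ) ≤ (q : ℝ) ^ α := one_le_pow₀ hqr.le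
  have hC : (0 : ℝ) ≤ C := Nat.cast_nonneg C
  have h0 := hle 0
  have hCq : 0 ≤ (C : ℝ) * (q : ℝ) ^ α := by positivity
  rw [abs_le]
  constructor
  · nlinarith
  · nlinarith

end PointCountBound

section Orbits

variable {α : Type*} {f : α → α} {x : α}

/-- The multiset `{x, f x, …, f^[N - 1] x}`. -/
def orbitMultiset (f : α → α) (N : ℕ) (x : α) : Multiset α :=
  (Multiset.range N).map fun i => f^[i] x

@[simp]
lemma card_orbitMultiset (N : ℕ) : (orbitMultiset f N x).card = N := by
  simp [orbitMultiset]

lemma map_orbitMultiset {N : ℕ} (h : Function.IsPeriodicPt f N x) :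
    (orbitMultiset f N x).map f = orbitMultiset f N x := by
  have h1 : (Multiset.range (N + 1)).map (fun i => f^[i] x) = x ::ₘ orbitMultiset f N x := by
    rw [Multiset.range_succ, Multiset.map_cons, h.eq, orbitMultiset]
  rw [add_comm, Multiset.range_add, Multiset.map_add, Multiset.map_map] at h1
  have h2 : (Multiset.range N).map ((fun i => f^[i] x) ∘ fun i => 1 + i) =
      (orbitMultiset f N x).map f := by
    rw [orbitMultiset, Multiset.map_map]
    refine Multiset.map_congr rfl fun i _ => ?_
    simp only [Function.comp_apply]
    rw [add_comm, Function.iterate_succ_apply']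
  rw [h2] at h1
  exact (Multiset.cons_inj_right x).1 (by simpa using h1)

lemma orbitMultiset_mul {δ : ℕ} (h : Function.IsPeriodicPt f δ x) (j : ℕ) :
    orbitMultiset f (j * δ) x = j • orbitMultiset f δ x := by
  induction j with
  | zero => simp [orbitMultiset]
  | succ j ih =>
    rw [succ_nsmul, ← ih, add_mul, one_mul, orbitMultiset, Multiset.range_add, Multiset.map_add,
      Multiset.map_map]
    refine congr_arg₂ _ rfl (Multiset.map_congr rfl fun i _ => ?_)
    simp only [Function.comp_apply]
    rw [add_comm, Function.iterate_add_apply, (h.const_mul j).eq]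

lemma exists_isPeriodicPt (hf : Function.Injective f) {m : Multiset α} (hm : m.map f = m)
    (hx : x ∈ m) : x ∈ Function.periodicPts f := by
  classical
  have hmem : ∀ i, f^[i] x ∈ m := by
    intro i
    induction i with
    | zero => exact hx
    | succ i ih =>
      rw [Function.iterate_succ_apply', ← hm]
      exact Multiset.mem_map_of_mem f ih
  obtain ⟨i, -, j, -, hij, h⟩ := Finset.exists_ne_map_eq_of_card_lt_of_maps_to
    (s := Finset.range (m.toFinset.card + 1)) (t := m.toFinset) (f := fun i => f^[i] x)
    (by simp) (fun i _ => Multiset.mem_toFinset.2 (hmem i))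
  rcases hij.lt_or_gt with hlt | hlt
  · exact Function.mk_mem_periodicPts (Nat.sub_pos_of_lt hlt) (Function.iterate_cancel hf h.symm)
  · exact Function.mk_mem_periodicPts (Nat.sub_pos_of_lt hlt) (Function.iterate_cancel hf h)

open Classical in
lemma card_orbitMultiset_le (hf : Function.Injective f) {m : Multiset α} (hm : m.map f = m)
    (hx : x ∈ m) : ((Finset.Icc 1 m.card).filter fun N =>
      Function.IsPeriodicPt f N x ∧ orbitMultiset f N x ≤ m).card = m.count x := by
  set δ := Function.minimalPeriod f x
  have hδ : 0 < δ := Function.minimalPeriod_pos_of_mem_periodicPts (exists_isPeriodicPt hf hm hx)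
  have hper : Function.IsPeriodicPt f δ x := Function.isPeriodicPt_minimalPeriod f x
  have hcount : ∀ i, m.count (f^[i] x) = m.count x := by
    intro i
    induction i with
    | zero => rfl
    | succ i ih =>
      rw [Function.iterate_succ_apply', ← ih]
      conv_lhs => rw [← hm]
      exact Multiset.count_map_eq_count' f m hf _
  have hnodup : (orbitMultiset f δ x).Nodup := by
    refine Multiset.Nodup.map_on (fun i hi j hj h => ?_) (Multiset.nodup_range δ)
    exact Function.iterate_injOn_Iio_minimalPeriod (Multiset.mem_range.1 hi)
      (Multiset.mem_range.1 hj) h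
  have hle : ∀ j, orbitMultiset f (j * δ) x ≤ m ↔ j ≤ m.count x := by
    intro j
    rw [orbitMultiset_mul hper, Multiset.le_iff_count]
    constructor
    · intro h
      have hx' : x ∈ orbitMultiset f δ x :=
        Multiset.mem_map.2 ⟨0, Multiset.mem_range.2 hδ, rfl⟩
      simpa [Multiset.count_nsmul, Multiset.count_eq_one_of_mem hnodup hx'] using h x
    · intro h y
      rw [Multiset.count_nsmul]
      by_cases hy : y ∈ orbitMultiset f δ x
      · rw [Multiset.count_eq_one_of_mem hnodup hy, mul_one]
        obtain ⟨i, -, rfl⟩ := Multiset.mem_map.1 hy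
        rwa [hcount]
      · rw [Multiset.count_eq_zero_of_notMem hy, mul_zero]
        exact Nat.zero_le _
  rw [show m.count x = (Finset.Icc 1 (m.count x)).card by simp]
  refine (Finset.card_bij (fun j _ => j * δ) ?_ ?_ ?_).symm
  · intro j hj
    rw [Finset.mem_Icc] at hj
    have h := (hle j).2 hj.2
    have hcard := Multiset.card_le_card h
    rw [card_orbitMultiset] at hcard
    exact Finset.mem_filter.2 ⟨Finset.mem_Icc.2 ⟨Nat.mul_pos hj.1 hδ, hcard⟩, hper.const_mul j, h⟩
  · intro i _ j _ h
    exact Nat.eq_of_mul_eq_mul_right hδ h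
  · intro N hN
    rw [Finset.mem_filter, Finset.mem_Icc] at hN
    obtain ⟨j, rfl⟩ := hN.2.1.minimalPeriod_dvd
    rw [mul_comm] at hN
    refine ⟨j, Finset.mem_Icc.2 ⟨?_, (hle j).1 hN.2.2⟩, mul_comm _ _⟩
    exact Nat.pos_of_ne_zero fun h => by simp [h] at hN

end Orbits

section ConjugatePolynomial

variable {F K : Type*} [Field F] [Fintype F] [Field K] [Algebra F K]

lemma iterate_frobenius (N : ℕ) (x : K) :
    (FiniteField.frobeniusAlgHom F K)^[N] x = x ^ Fintype.card F ^ N := by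
  induction N with
  | zero => simp
  | succ N ih =>
    rw [Function.iterate_succ_apply', ih, FiniteField.coe_frobeniusAlgHom]
    simp only [← pow_mul, pow_succ]

variable (F) in
/-- The multiset `{x, x ^ q, …, x ^ (q ^ (N - 1))}`. -/
noncomputable def conjugates (N : ℕ) (x : K) : Multiset K :=
  orbitMultiset (FiniteField.frobeniusAlgHom F K) N x

lemma exists_conjPoly {N : ℕ} {x : K} (hx : x ^ Fintype.card F ^ N = x) :
    ∃ h : F[X], h.map (algebraMap F K) = ((conjugates F N x).map fun a => X - C a).prod := by
  have hper : Function.IsPeriodicPt (FiniteField.frobeniusAlgHom F K) N x := by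
    rw [Function.IsPeriodicPt, Function.IsFixedPt, iterate_frobenius, hx]
  set H : K[X] := ((conjugates F N x).map fun a => X - C a).prod with hH
  have hmap : H.map (FiniteField.frobeniusAlgHom F K : K →+* K) = H := by
    rw [hH, Polynomial.map_multiset_prod, Multiset.map_map]
    conv_rhs => rw [conjugates, ← map_orbitMultiset hper, Multiset.map_map]
    refine congr_arg _ (Multiset.map_congr rfl fun a _ => ?_)
    simp
  have hlift : H ∈ lifts (algebraMap F K) := by
    rw [lifts_iff_coeff_lifts]
    intro n
    have h1 := congr_arg (fun P => P.coeff n) hmap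
    simp only [coeff_map, RingHom.coe_coe, FiniteField.coe_frobeniusAlgHom] at h1
    exact exists_algebraMap_eq h1
  obtain ⟨h, hh⟩ := (mem_lifts _).1 hlift
  exact ⟨h, hh⟩

open Classical in
variable (F) in
/-- The polynomial over `F` whose roots are the conjugates of `x` (with the convention `1` when `x`
does not satisfy `x ^ (q ^ N) = x`). -/
noncomputable def conjPoly (N : ℕ) (x : K) : F[X] :=
  if hx : x ^ Fintype.card F ^ N = x then (exists_conjPoly hx).choose else 1

lemma map_conjPoly {N : ℕ} {x : K} (hx : x ^ Fintype.card F ^ N = x) :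
    (conjPoly F N x).map (algebraMap F K) = ((conjugates F N x).map fun a => X - C a).prod := by
  rw [conjPoly, dif_pos hx]
  exact (exists_conjPoly hx).choose_spec

lemma monic_conjPoly {N : ℕ} {x : K} (hx : x ^ Fintype.card F ^ N = x) :
    (conjPoly F N x).Monic := by
  refine monic_of_injective (algebraMap F K).injective ?_
  rw [map_conjPoly hx]
  exact monic_multisetProd_X_sub_C _

lemma natDegree_conjPoly {N : ℕ} {x : K} (hx : x ^ Fintype.card F ^ N = x) :
    (conjPoly F N x).natDegree = N := by
  rw [← natDegree_map (algebraMap F K), map_conjPoly hx, natDegree_multiset_prod_X_sub_C_eq_card,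
    conjugates, card_orbitMultiset]

lemma aroots_conjPoly {N : ℕ} {x : K} (hx : x ^ Fintype.card F ^ N = x) :
    (conjPoly F N x).aroots K = conjugates F N x := by
  rw [aroots, map_conjPoly hx, roots_multiset_prod_X_sub_C]

lemma conjPoly_dvd_iff {N : ℕ} {x : K} (hx : x ^ Fintype.card F ^ N = x) {f : F[X]} (hf : f ≠ 0) :
    conjPoly F N x ∣ f ↔ conjugates F N x ≤ f.aroots K := by
  rw [← map_dvd_map' (algebraMap F K), map_conjPoly hx,
    Multiset.prod_X_sub_C_dvd_iff_le_roots (map_ne_zero hf)]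

lemma map_aroots [IsAlgClosed K] (f : F[X]) :
    (f.aroots K).map (FiniteField.frobeniusAlgHom F K) = f.aroots K := by
  have h := (IsAlgClosed.splits (f.map (algebraMap F K))).roots_map
    (FiniteField.frobeniusAlgHom F K : K →+* K)
  rw [Polynomial.map_map] at h
  have h2 : ((FiniteField.frobeniusAlgHom F K : K →+* K).comp (algebraMap F K)) =
    algebraMap F K := (FiniteField.frobeniusAlgHom F K).comp_algebraMap
  rw [h2] at h
  exact h.symm

open Classical in
/-- The degree of `f` counts the pairs `(N, x)` for which the conjugate polynomial divides `f`. -/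
lemma sum_card_conjPoly_dvd [IsAlgClosed K] {f : F[X]} (hf : f.coeff 0 ≠ 0) :
    ∑ N ∈ Finset.Icc 1 f.natDegree,
      ((cyclicUnits F K N).filter fun x => conjPoly F N x ∣ f).card = f.natDegree := by
  have hf0 : f ≠ 0 := by
    rintro rfl
    simp at hf
  have hcard : (f.aroots K).card = f.natDegree := by
    rw [aroots, ← (IsAlgClosed.splits _).natDegree_eq_card_roots, natDegree_map]
  have hinj : Function.Injective (FiniteField.frobeniusAlgHom F K) := RingHom.injective _
  have hmem : ∀ N ∈ Finset.Icc 1 f.natDegree,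
      ((cyclicUnits F K N).filter fun x => conjPoly F N x ∣ f) = (f.aroots K).toFinset.filter
        fun x => Function.IsPeriodicPt (FiniteField.frobeniusAlgHom F K) N x ∧
          orbitMultiset (FiniteField.frobeniusAlgHom F K) N x ≤ f.aroots K := by
    intro N hN
    ext x
    rw [Finset.mem_Icc] at hN
    rw [Finset.mem_filter, Finset.mem_filter, mem_cyclicUnits hN.1, Multiset.mem_toFinset,
      Function.IsPeriodicPt, Function.IsFixedPt, iterate_frobenius]
    constructor
    · rintro ⟨⟨-, hx⟩, hdvd⟩
      have hle := (conjPoly_dvd_iff hx hf0).1 hdvd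
      exact ⟨Multiset.mem_of_le hle (Multiset.mem_map.2 ⟨0, Multiset.mem_range.2 hN.1, rfl⟩),
        hx, hle⟩
    · rintro ⟨hmem, hx, hle⟩
      refine ⟨⟨?_, hx⟩, (conjPoly_dvd_iff hx hf0).2 hle⟩
      rintro rfl
      rw [mem_aroots] at hmem
      have := hmem.2
      rw [aeval_def, eval₂_at_zero, map_eq_zero] at this
      exact hf this
  rw [Finset.sum_congr rfl fun N hN => congr_arg Finset.card (hmem N hN)]
  simp only [Finset.card_filter]
  rw [Finset.sum_comm]
  simp only [← Finset.card_filter]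
  rw [← hcard]
  refine Eq.trans (Finset.sum_congr rfl fun x hx => ?_)
    (Multiset.toFinset_sum_count_eq (f.aroots K))
  exact card_orbitMultiset_le hinj (map_aroots f) (Multiset.mem_toFinset.1 hx)

end ConjugatePolynomial

section NewtonRecursion

variable {F : Type*} [Field F] [Fintype F]

open Classical in
lemma sum_monicPoly_dvd (χ : F[X] →* ℂ) {h : F[X]} (hh : h.Monic) {r s : ℕ}
    (hr : h.natDegree + s = r) :
    ∑ y : Fin r → F, (if h ∣ monicPoly y then χ (monicPoly y) else 0) = χ h * monicSum χ s := by
  have hdeg : ∀ y : Fin s → F, (h * monicPoly y).natDegree = r := fun y => by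
    rw [hh.natDegree_mul (monic_monicPoly y), natDegree_monicPoly, hr]
  have hmul : ∀ y : Fin s → F,
      monicPoly (fun i : Fin r => (h * monicPoly y).coeff i) = h * monicPoly y :=
    fun y => monicPoly_coeff (hh.mul (monic_monicPoly y)) (hdeg y)
  rw [monicSum, Finset.mul_sum, ← Finset.sum_filter]
  refine (Finset.sum_bij (fun y _ (i : Fin r) => (h * monicPoly y).coeff i) ?_ ?_ ?_ ?_).symm
  · intro y _
    rw [Finset.mem_filter, hmul]
    exact ⟨Finset.mem_univ _, dvd_mul_right _ _⟩
  · intro y _ z _ hyz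
    have h1 := congr_arg (monicPoly : (Fin r → F) → F[X]) hyz
    rw [hmul, hmul] at h1
    exact monicPoly_injective (mul_left_cancel₀ hh.ne_zero h1)
  · intro z hz
    obtain ⟨g, hg⟩ := (Finset.mem_filter.1 hz).2
    have hgm : g.Monic := hh.of_mul_monic_left (hg ▸ monic_monicPoly z)
    have hgd : g.natDegree = s := by
      have h1 := natDegree_monicPoly z
      rw [hg, hh.natDegree_mul hgm] at h1
      omega
    refine ⟨fun i => g.coeff i, Finset.mem_univ _, monicPoly_injective ?_⟩
    rw [hmul, monicPoly_coeff hgm hgd, hg]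
  · intro y _
    rw [hmul, map_mul]

variable (K : Type*) [Field K] [Algebra F K]

/-- The sum of `χ` over the minimal polynomials (with multiplicity) of the units of the extension
of degree `N`. -/
noncomputable def primeSum (χ : F[X] →* ℂ) (N : ℕ) : ℂ :=
  ∑ x ∈ cyclicUnits F K N, χ (conjPoly F N x)

/-- Logarithmic differentiation of the generating series of `monicSum χ`. -/
theorem monicSum_newton [IsAlgClosed K] {χ : F[X] →* ℂ} (hχ : ∀ f, f.coeff 0 = 0 → χ f = 0)
    (r : ℕ) : (r : ℂ) * monicSum χ r =
      ∑ N ∈ Finset.range r, primeSum K χ (N + 1) * monicSum χ (r - (N + 1)) := by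
  classical
  have h1 : ∀ y : Fin r → F, (r : ℂ) * χ (monicPoly y) = ∑ N ∈ Finset.Icc 1 r,
      ∑ x ∈ cyclicUnits F K N, if conjPoly F N x ∣ monicPoly y then χ (monicPoly y) else 0 := by
    intro y
    by_cases hy : (monicPoly y).coeff 0 = 0
    · simp [hχ _ hy]
    · have h2 := sum_card_conjPoly_dvd (K := K) hy
      rw [natDegree_monicPoly] at h2
      rw [← congr_arg (Nat.cast : ℕ → ℂ) h2, Nat.cast_sum, Finset.sum_mul]
      refine Finset.sum_congr rfl fun N _ => ?_
      rw [← Finset.sum_filter, Finset.sum_const, nsmul_eq_mul]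
  have h2 : ∀ N ∈ Finset.Icc 1 r, ∀ x ∈ cyclicUnits F K N, ∑ y : Fin r → F,
      (if conjPoly F N x ∣ monicPoly y then χ (monicPoly y) else 0) =
        χ (conjPoly F N x) * monicSum χ (r - N) := by
    intro N hN x hx
    rw [Finset.mem_Icc] at hN
    have hx' := ((mem_cyclicUnits hN.1).1 hx).2
    refine sum_monicPoly_dvd χ (monic_conjPoly hx') ?_
    rw [natDegree_conjPoly hx']
    omega
  rw [monicSum, Finset.mul_sum, Finset.sum_congr rfl fun y _ => h1 y, Finset.sum_comm]
  have h3 := Finset.sum_Ico_add' (fun N => primeSum K χ N * monicSum χ (r - N)) 0 r 1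
  rw [← Finset.range_eq_Ico] at h3
  rw [h3]
  refine Finset.sum_congr rfl fun N hN => ?_
  rw [Finset.sum_comm, Finset.sum_congr rfl (h2 N hN), ← Finset.sum_mul, primeSum]

lemma monicSum_zero (χ : F[X] →* ℂ) : monicSum χ 0 = 1 := by
  simp [monicSum, monicPoly]

lemma matrixMean_zero [DecidableEq F] (χ : F[X] →* ℂ) : matrixMean χ 0 = 1 := by
  have h : Fintype.card (Matrix (Fin 0) (Fin 0) F) = 1 :=
    Fintype.card_eq_one_iff_nonempty_unique.2 ⟨⟨⟨0⟩, fun _ => Subsingleton.elim _ _⟩⟩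
  simp [matrixMean, h]

end NewtonRecursion

section NewtonIdentities

variable {K : Type*} [Field K]

/-- The polynomial `∏ (1 - a X)`. -/
noncomputable def reciprocalPoly (A : Multiset K) : K[X] :=
  (A.map fun a => 1 - C a * X).prod

/-- The sum of the `j`-th powers of the elements of a multiset. -/
def powerSum (A : Multiset K) (j : ℤ) : K := (A.map fun a => a ^ j).sum

lemma derivative_reciprocalPoly (A : Multiset K) : (derivative (reciprocalPoly A) : PowerSeries K) =
    -(PowerSeries.mk fun N => powerSum A (N + 1)) * (reciprocalPoly A : PowerSeries K) := by
  induction A using Multiset.induction with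
  | empty => simp [reciprocalPoly, powerSum, PowerSeries.ext_iff]
  | cons a A ih =>
    have h1 : reciprocalPoly (a ::ₘ A) = (1 - C a * X) * reciprocalPoly A := by
      simp [reciprocalPoly]
    have h2 : (PowerSeries.mk fun N => powerSum (a ::ₘ A) (N + 1)) =
        (PowerSeries.mk fun N => a ^ (N + 1)) + PowerSeries.mk fun N => powerSum A (N + 1) := by
      ext N
      simp only [powerSum, Multiset.map_cons, Multiset.sum_cons, PowerSeries.coeff_mk, map_add]
      norm_cast
    have h3 : (PowerSeries.mk fun N => a ^ (N + 1)) * (1 - PowerSeries.C a * PowerSeries.X) =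
        PowerSeries.C a := by
      ext N
      rw [mul_sub, mul_one, mul_left_comm, map_sub]
      cases N with
      | zero => simp
      | succ N => simp [pow_succ, mul_comm]
    have h4 : derivative (reciprocalPoly (a ::ₘ A)) =
        -C a * reciprocalPoly A + (1 - C a * X) * derivative (reciprocalPoly A) := by
      rw [h1, derivative_mul]
      simp
    rw [h2, h4, h1]
    simp only [Polynomial.coe_add, Polynomial.coe_mul, Polynomial.coe_sub, Polynomial.coe_neg,
      Polynomial.coe_one, Polynomial.coe_C, Polynomial.coe_X, ih]
    linear_combination (-(reciprocalPoly A : PowerSeries K)) * h3.symm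

lemma reciprocalPoly_newton (A : Multiset K) (N : ℕ) :
    (reciprocalPoly A).coeff (N + 1) * (N + 1) =
      -∑ i ∈ Finset.range (N + 1), powerSum A (i + 1) * (reciprocalPoly A).coeff (N - i) := by
  have h := congr_arg (PowerSeries.coeff N) (derivative_reciprocalPoly A)
  rw [coeff_coe, coeff_derivative, neg_mul, map_neg, PowerSeries.coeff_mul,
    Finset.Nat.sum_antidiagonal_eq_sum_range_succ_mk] at h
  simpa using h

lemma coeff_zero_reciprocalPoly (A : Multiset K) : (reciprocalPoly A).coeff 0 = 1 := by
  rw [reciprocalPoly, coeff_zero_multiset_prod, Multiset.map_map]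
  simp

/-- The power sums of two multisets agree to the order to which their reciprocal polynomials do, and
the first difference is explicit. -/
lemma powerSum_sub_powerSum {A B : Multiset K} {j : ℕ} (hj : 0 < j)
    (h : ∀ i < j, (reciprocalPoly A).coeff i = (reciprocalPoly B).coeff i) :
    powerSum A j - powerSum B j =
      -j * ((reciprocalPoly A).coeff j - (reciprocalPoly B).coeff j) := by
  induction j using Nat.strong_induction_on with
  | _ j ih =>
    obtain ⟨N, rfl⟩ : ∃ N, j = N + 1 := ⟨j - 1, by omega⟩
    have hA := reciprocalPoly_newton A N
    have hB := reciprocalPoly_newton B N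
    rw [Finset.sum_range_succ, Nat.sub_self, coeff_zero_reciprocalPoly] at hA hB
    have hsum : ∑ i ∈ Finset.range N, powerSum A (i + 1) * (reciprocalPoly A).coeff (N - i) =
        ∑ i ∈ Finset.range N, powerSum B (i + 1) * (reciprocalPoly B).coeff (N - i) := by
      refine Finset.sum_congr rfl fun i hi => ?_
      have hi' := Finset.mem_range.1 hi
      have h1 := ih (i + 1) (by omega) (by omega) fun l hl => h l (by omega)
      rw [h (i + 1) (by omega), sub_self, mul_zero, sub_eq_zero] at h1
      rw [h (N - i) (by omega)]
      push_cast at h1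
      rw [h1]
    push_cast
    linear_combination hA - hB - hsum

lemma powerSum_map_inv (A : Multiset K) (j : ℤ) :
    powerSum (A.map fun a => a⁻¹) j = powerSum A (-j) := by
  simp [powerSum]

end NewtonIdentities

section RootPowerSums

variable {F K : Type*} [Field F] [Field K] [Algebra F K] [IsAlgClosed K]

lemma reciprocalPoly_aroots {f : F[X]} (hf : f.Monic) :
    reciprocalPoly (f.aroots K) = (f.map (algebraMap F K)).reverse := by
  have h1 : ∀ A : Multiset K, reciprocalPoly A = ((A.map fun a => X - C a).prod).reverse := by
    intro A
    induction A using Multiset.induction with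
    | empty => simpa [reciprocalPoly] using (reverse_C (1 : K)).symm
    | cons a A ih =>
      have h2 : (X - C a).reverse = 1 - C a * X := by
        rw [reverse, natDegree_X_sub_C, reflect_sub, reflect_one_X, reflect_C, pow_one]
      rw [Multiset.map_cons, Multiset.prod_cons, reverse_mul_of_domain, ← ih, h2, reciprocalPoly,
        reciprocalPoly, Multiset.map_cons, Multiset.prod_cons]
  rw [h1, aroots, ← (IsAlgClosed.splits _).eq_prod_roots_of_monic (hf.map _)]

lemma coeff_reciprocalPoly_aroots {f : F[X]} (hf : f.Monic) {i : ℕ} (hi : i ≤ f.natDegree) :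
    (reciprocalPoly (f.aroots K)).coeff i = algebraMap F K (f.coeff (f.natDegree - i)) := by
  rw [reciprocalPoly_aroots hf, coeff_reverse, natDegree_map, revAt_le hi, coeff_map]

lemma coeff_reciprocalPoly_aroots_inv {f : F[X]} (hf : f.Monic) (hf0 : f.coeff 0 ≠ 0) (i : ℕ) :
    (reciprocalPoly ((f.aroots K).map fun a => a⁻¹)).coeff i =
      algebraMap F K (f.coeff i / f.coeff 0) := by
  have h1 : ∀ A : Multiset K, 0 ∉ A → reciprocalPoly (A.map fun a => a⁻¹) *
      C ((A.map fun a => X - C a).prod.coeff 0) = (A.map fun a => X - C a).prod := by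
    intro A
    induction A using Multiset.induction with
    | empty => simp [reciprocalPoly]
    | cons a A ih =>
      intro hA
      rw [Multiset.mem_cons, not_or] at hA
      have ha : C a⁻¹ * C a = (1 : K[X]) := by
        rw [← C_mul, inv_mul_cancel₀ (Ne.symm hA.1), C_1]
      have h2 : reciprocalPoly ((a ::ₘ A).map fun a => a⁻¹) =
        (1 - C a⁻¹ * X) * reciprocalPoly (A.map fun a => a⁻¹) := by simp [reciprocalPoly]
      rw [h2, Multiset.map_cons, Multiset.prod_cons, mul_coeff_zero, C_mul]
      conv_rhs => rw [← ih hA.2]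
      simp only [coeff_sub, coeff_X_zero, coeff_C_zero, zero_sub, C_neg]
      linear_combination (X * reciprocalPoly (A.map fun a => a⁻¹) *
        C ((A.map fun a => X - C a).prod.coeff 0)) * ha
  have h0 : (0 : K) ∉ f.aroots K := by
    intro h
    rw [mem_aroots, aeval_def, eval₂_at_zero, map_eq_zero] at h
    exact hf0 h.2
  have h2 := h1 _ h0
  rw [aroots, ← (IsAlgClosed.splits _).eq_prod_roots_of_monic (hf.map _), coeff_map] at h2
  have h3 := congr_arg (fun P => P.coeff i) h2
  simp only [coeff_mul_C, coeff_map] at h3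
  rw [map_div₀, eq_div_iff ((_root_.map_ne_zero _).2 hf0), h3]

end RootPowerSums

section TraceCharacter

variable {F K : Type*} [Field F] [Field K] [Algebra F K]

lemma sum_map_laurentEval {k : ℕ} (b : Fin k → ℤ) (t : Fin k → K) (A : Multiset K) :
    (A.map (laurentEval b t)).sum = ∑ i, t i * powerSum A (b i) := by
  induction A using Multiset.induction with
  | empty => simp [powerSum]
  | cons a A ih =>
    simp only [powerSum, Multiset.map_cons, Multiset.sum_cons, mul_add, Finset.sum_add_distrib]
      at ih ⊢
    rw [ih, laurentEval]

/-- The completely multiplicative function sending a monic polynomial with roots `x` to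
`lam (∏ x) * ψ (s (∑ g x))`. -/
noncomputable def traceChar [IsAlgClosed K] (ψ : AddChar F ℂ) (lam : MulChar F ℂ) (s : K →ₗ[F] F)
    (g : K → K) : F[X] →* ℂ where
  toFun f := lam ((-1) ^ f.natDegree * f.coeff 0) * ψ (s ((f.aroots K).map g).sum)
  map_one' := by simp
  map_mul' f h := by
    rcases eq_or_ne f 0 with rfl | hf
    · simp [MulChar.map_zero]
    rcases eq_or_ne h 0 with rfl | hh
    · simp [MulChar.map_zero]
    rw [natDegree_mul hf hh, aroots_mul (mul_ne_zero hf hh), mul_coeff_zero, Multiset.map_add,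
      Multiset.sum_add, map_add, AddChar.map_add_eq_mul, pow_add, mul_mul_mul_comm, map_mul]
    ring

variable [IsAlgClosed K]

lemma traceChar_apply (ψ : AddChar F ℂ) (lam : MulChar F ℂ) (s : K →ₗ[F] F) (g : K → K) (f : F[X]) :
    traceChar ψ lam s g f =
      lam ((-1) ^ f.natDegree * f.coeff 0) * ψ (s ((f.aroots K).map g).sum) := rfl

lemma traceChar_eq_zero {ψ : AddChar F ℂ} {lam : MulChar F ℂ} {s : K →ₗ[F] F} {g : K → K} {f : F[X]}
    (hf : f.coeff 0 = 0) : traceChar ψ lam s g f = 0 := by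
  rw [traceChar_apply, hf, mul_zero, MulChar.map_zero, zero_mul]

end TraceCharacter

section Vanishing

variable {F : Type*} [Field F]

lemma monicPoly_add_single {r : ℕ} (y : Fin r → F) (i : Fin r) (u : F) :
    monicPoly (y + Pi.single i u) = monicPoly y + C u * X ^ (i : ℕ) := by
  have h : ∑ j, C ((Pi.single i u : Fin r → F) j) * X ^ (j : ℕ) = C u * X ^ (i : ℕ) := by
    rw [Finset.sum_eq_single i]
    · simp
    · intro j _ hj
      simp [hj]
    · simp
  simp only [monicPoly, Pi.add_apply, map_add, add_mul, Finset.sum_add_distrib, h, add_assoc]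

lemma monicSum_eq_zero_of_shift [Fintype F] {ψ : AddChar F ℂ} (hψ : ψ.IsPrimitive)
    (χ : F[X] →* ℂ) {r : ℕ} (i : Fin r) (c : (Fin r → F) → F)
    (hc : ∀ y, χ (monicPoly y) ≠ 0 → c y ≠ 0)
    (h : ∀ y u, χ (monicPoly y + C u * X ^ (i : ℕ)) = χ (monicPoly y) * ψ (u * c y)) :
    monicSum χ r = 0 := by
  classical
  have h1 : ∀ u, monicSum χ r = ∑ y, χ (monicPoly y) * ψ (u * c y) := by
    intro u
    rw [monicSum, ← Equiv.sum_comp (Equiv.addRight (Pi.single i u : Fin r → F))]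
    refine Finset.sum_congr rfl fun y _ => ?_
    rw [Equiv.coe_addRight, monicPoly_add_single, h]
  have h2 : (Fintype.card F : ℂ) * monicSum χ r = 0 := by
    rw [← nsmul_eq_mul, ← Finset.card_univ, ← Finset.sum_const,
      Finset.sum_congr rfl fun u _ => h1 u, Finset.sum_comm]
    refine Finset.sum_eq_zero fun y _ => ?_
    rw [← Finset.mul_sum]
    by_cases hy : χ (monicPoly y) = 0
    · rw [hy, zero_mul]
    · rw [AddChar.sum_mulShift _ hψ, if_neg (hc y hy), Nat.cast_zero, mul_zero]
  exact (mul_eq_zero.1 h2).resolve_left (Nat.cast_ne_zero.2 Fintype.card_ne_zero)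

variable {K : Type*} [Field K] [Algebra F K] [IsAlgClosed K] {r : ℕ}

lemma powerSum_aroots_sub {f h : F[X]} (hf : f.Monic) (hh : h.Monic)
    (hfr : f.natDegree = r) (hhr : h.natDegree = r) {j : ℕ} (hj : 0 < j) (hjr : j ≤ r)
    (hcoeff : ∀ i < j, h.coeff (r - i) = f.coeff (r - i)) :
    powerSum (h.aroots K) j - powerSum (f.aroots K) j =
      algebraMap F K (-j * (h.coeff (r - j) - f.coeff (r - j))) := by
  rw [powerSum_sub_powerSum hj, coeff_reciprocalPoly_aroots hf (by omega),
    coeff_reciprocalPoly_aroots hh (by omega), hfr, hhr]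
  · simp
  · intro i hi
    rw [coeff_reciprocalPoly_aroots hf (by omega), coeff_reciprocalPoly_aroots hh (by omega), hfr,
      hhr, hcoeff i hi]

lemma powerSum_aroots_neg_sub {f h : F[X]} (hf : f.Monic) (hh : h.Monic)
    (hf0 : f.coeff 0 ≠ 0) {j : ℕ} (hj : 0 < j) (hcoeff : ∀ i < j, h.coeff i = f.coeff i) :
    powerSum (h.aroots K) (-j) - powerSum (f.aroots K) (-j) =
      algebraMap F K (-j * ((h.coeff j - f.coeff j) / f.coeff 0)) := by
  have h0 := hcoeff 0 hj
  rw [← powerSum_map_inv, ← powerSum_map_inv, powerSum_sub_powerSum hj,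
    coeff_reciprocalPoly_aroots_inv hf hf0, coeff_reciprocalPoly_aroots_inv hh (h0 ▸ hf0), h0]
  · simp [sub_div]
  · intro i hi
    rw [coeff_reciprocalPoly_aroots_inv hf hf0, coeff_reciprocalPoly_aroots_inv hh (h0 ▸ hf0), h0,
      hcoeff i hi]

variable {k : ℕ} {b : Fin k → ℤ} {t : Fin k → F} {s : K →ₗ[F] F} {lam : MulChar F ℂ}
  {ψ : AddChar F ℂ}

lemma traceChar_shift (hs : ∀ x, s (algebraMap F K x) = x) {f h : F[X]}
    (hdeg : h.natDegree = f.natDegree) (h0 : h.coeff 0 = f.coeff 0) (j : Fin k) (v : F)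
    (hv : f.coeff 0 ≠ 0 → ∀ i, t i ≠ 0 → powerSum (h.aroots K) (b i) - powerSum (f.aroots K) (b i) =
      if i = j then algebraMap F K v else 0) :
    traceChar ψ lam s (laurentEval b (algebraMap F K ∘ t)) h =
      traceChar ψ lam s (laurentEval b (algebraMap F K ∘ t)) f * ψ (t j * v) := by
  by_cases hf : f.coeff 0 = 0
  · rw [traceChar_eq_zero hf, traceChar_eq_zero (h0.trans hf), zero_mul]
  · rw [traceChar_apply, traceChar_apply, hdeg, h0, mul_assoc, ← AddChar.map_add_eq_mul]
    congr 2
    rw [← sub_eq_iff_eq_add', ← map_sub, sum_map_laurentEval, sum_map_laurentEval,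
      ← Finset.sum_sub_distrib, Finset.sum_eq_single j]
    · by_cases htj : t j = 0
      · simp [htj]
      · rw [← mul_sub, hv hf j htj, if_pos rfl, Function.comp_apply, ← map_mul, hs]
    · intro i _ hij
      by_cases hti : t i = 0
      · simp [hti]
      · rw [← mul_sub, hv hf i hti, if_neg hij, mul_zero]
    · simp

/-- The sums of the character attached to a nonzero Laurent polynomial over the monic polynomials of
large degree vanish. -/
theorem monicSum_traceChar_eq_zero [Fintype F] (p : ℕ) [CharP F p] (hψ : ψ.IsPrimitive)
    (hs : ∀ x, s (algebraMap F K x) = x) (hb : b.Injective) (hbp : ∀ i, ¬ (p : ℤ) ∣ b i)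
    (ht : t ≠ 0) {l m : ℕ} (hl : ∀ i, b i ≤ l) (hm : ∀ i, -(m : ℤ) ≤ b i) (hr : l + m < r) :
    monicSum (traceChar ψ lam s (laurentEval b (algebraMap F K ∘ t))) r = 0 := by
  classical
  have hb0 : ∀ i, b i ≠ 0 := fun i h => hbp i (h ▸ dvd_zero _)
  have hbF : ∀ i, (b i : F) ≠ 0 := fun i h => hbp i ((CharP.intCast_eq_zero_iff F p _).1 h)
  obtain ⟨i₀, hi₀⟩ := Function.ne_iff.1 ht
  have hT : (Finset.univ.filter fun i => t i ≠ 0).Nonempty := ⟨i₀, by simpa using hi₀⟩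
  obtain ⟨jmax, hj1, hjmax⟩ := Finset.exists_max_image _ b hT
  obtain ⟨jmin, hj2, hjmin⟩ := Finset.exists_min_image _ b hT
  simp only [Finset.mem_filter, Finset.mem_univ, true_and] at hj1 hj2 hjmax hjmin
  have hdeg : ∀ (y : Fin r → F) (u : F) (i : Fin r),
      (monicPoly y + C u * X ^ (i : ℕ)).Monic ∧
        (monicPoly y + C u * X ^ (i : ℕ)).natDegree = r := fun y u i => by
    rw [← monicPoly_add_single]
    exact ⟨monic_monicPoly _, natDegree_monicPoly _⟩
  rcases lt_or_ge 0 (b jmax) with hpos | hneg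
  · obtain ⟨β, hβ⟩ := Int.eq_ofNat_of_zero_le hpos.le
    have hβl := hl jmax
    refine monicSum_eq_zero_of_shift hψ _ ⟨r - β, by omega⟩ (fun _ => t jmax * -b jmax) ?_ ?_
    · exact fun _ _ => mul_ne_zero hj1 (neg_ne_zero.2 (hbF _))
    · intro y u
      obtain ⟨hmon, hd⟩ := hdeg y u ⟨r - β, by omega⟩
      rw [mul_left_comm]
      refine traceChar_shift hs (hd.trans (natDegree_monicPoly y).symm) ?_ _ _ ?_
      · rw [coeff_add, coeff_C_mul_X_pow, if_neg (by simp; omega), add_zero]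
      · intro hy0 i hi
        have hle := hjmax i hi
        rcases lt_or_gt_of_ne (hb0 i) with h | h
        · obtain ⟨j, hj⟩ := Int.exists_eq_neg_ofNat h.le
          have := hm i
          rw [hj, powerSum_aroots_neg_sub (monic_monicPoly y) hmon hy0 (by omega),
            coeff_add, coeff_C_mul_X_pow, if_neg (by simp; omega), if_neg]
          · simp
          · rintro rfl
            omega
          · intro i' hi'
            rw [coeff_add, coeff_C_mul_X_pow, if_neg (by simp; omega), add_zero]
        · obtain ⟨j, hj⟩ := Int.eq_ofNat_of_zero_le h.le
          rw [hj, powerSum_aroots_sub (monic_monicPoly y) hmon (natDegree_monicPoly y) hd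
            (by omega) (by omega), coeff_add, coeff_C_mul_X_pow]
          · by_cases hij : i = jmax
            · subst hij
              rw [if_pos rfl, if_pos (by simp; omega), hj]
              congr 1
              push_cast
              ring
            · have : b i ≠ b jmax := fun h => hij (hb h)
              rw [if_neg hij, if_neg (by simp; omega)]
              simp
          · intro i' hi'
            rw [coeff_add, coeff_C_mul_X_pow, if_neg (by simp; omega), add_zero]
  · have hlt : ∀ i, t i ≠ 0 → b i < 0 := fun i hi =>
      lt_of_le_of_ne ((hjmax i hi).trans hneg) (hb0 i)
    obtain ⟨β, hβ⟩ := Int.exists_eq_neg_ofNat (hlt jmin hj2).le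
    have hβm := hm jmin
    have hβ0 := hlt jmin hj2
    refine monicSum_eq_zero_of_shift hψ _ ⟨β, by omega⟩
      (fun y => t jmin * (b jmin / (monicPoly y).coeff 0)) ?_ ?_
    · intro y hy
      refine mul_ne_zero hj2 (div_ne_zero (hbF _) fun h0 => hy (traceChar_eq_zero h0))
    · intro y u
      obtain ⟨hmon, hd⟩ := hdeg y u ⟨β, by omega⟩
      rw [mul_left_comm]
      refine traceChar_shift hs (hd.trans (natDegree_monicPoly y).symm) ?_ _ _ ?_
      · rw [coeff_add, coeff_C_mul_X_pow, if_neg (by simp; omega), add_zero]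
      · intro hy0 i hi
        have hle := hjmin i hi
        have h := hlt i hi
        obtain ⟨j, hj⟩ := Int.exists_eq_neg_ofNat h.le
        rw [hj, powerSum_aroots_neg_sub (monic_monicPoly y) hmon hy0 (by omega),
          coeff_add, coeff_C_mul_X_pow]
        · by_cases hij : i = jmin
          · subst hij
            rw [if_pos rfl, if_pos (by simp; omega), hj]
            congr 1
            push_cast
            ring
          · have : b i ≠ b jmin := fun h => hij (hb h)
            rw [if_neg hij, if_neg (by simp; omega)]
            simp
        · intro i' hi'
          rw [coeff_add, coeff_C_mul_X_pow, if_neg (by simp; omega), add_zero]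

end Vanishing

section PowerSums

/-- If the power sums of a finite family stay bounded then the family lies in the unit disc. -/
lemma norm_le_one_of_powerSum_bounded {ι : Type*} [Fintype ι] (w : ι → ℂ) {B : ℝ} {n₀ : ℕ}
    (h : ∀ n ≥ n₀, ‖∑ i, w i ^ n‖ ≤ B) (i : ι) : ‖w i‖ ≤ 1 := by
  classical
  set L : ℂ[X] := ∏ v ∈ (Finset.univ.image w).erase (w i), (X - C v) with hL
  have hLi : L.eval (w i) ≠ 0 := by
    rw [hL, eval_prod, Finset.prod_ne_zero_iff]
    intro v hv
    simpa [sub_eq_zero] using (Finset.ne_of_mem_erase hv).symm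
  have hLj : ∀ j, w j ≠ w i → L.eval (w j) = 0 := by
    intro j hj
    rw [hL, eval_prod]
    exact Finset.prod_eq_zero (Finset.mem_erase.2 ⟨hj,
      Finset.mem_image_of_mem w (Finset.mem_univ j)⟩)
      (by simp)
  set m := (Finset.univ.filter fun j => w j = w i).card
  have hm : (m : ℂ) ≠ 0 := by
    rw [Nat.cast_ne_zero]
    exact Finset.card_ne_zero_of_mem (Finset.mem_filter.2 ⟨Finset.mem_univ i, rfl⟩)
  have hsum : ∀ n, (m : ℂ) * L.eval (w i) * w i ^ n =
      ∑ l ∈ Finset.range (L.natDegree + 1), L.coeff l * ∑ j, w j ^ (n + l) := by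
    intro n
    have h1 : ∑ j, L.eval (w j) * w j ^ n = (m : ℂ) * L.eval (w i) * w i ^ n := by
      rw [← Finset.sum_filter_add_sum_filter_not _ (fun j => w j = w i),
        Finset.sum_eq_zero (s := Finset.univ.filter fun j => ¬ w j = w i), add_zero]
      · rw [Finset.sum_congr rfl (g := fun _ => L.eval (w i) * w i ^ n), Finset.sum_const,
          nsmul_eq_mul, mul_assoc]
        intro j hj
        rw [(Finset.mem_filter.1 hj).2]
      · intro j hj
        rw [hLj j (Finset.mem_filter.1 hj).2, zero_mul]
    rw [← h1]
    simp only [eval_eq_sum_range, Finset.sum_mul, Finset.mul_sum]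
    rw [Finset.sum_comm]
    exact Finset.sum_congr rfl fun _ _ => Finset.sum_congr rfl fun _ _ => by ring
  by_contra! hgt
  have hpos : 0 < ‖(m : ℂ) * L.eval (w i)‖ := norm_pos_iff.2 (mul_ne_zero hm hLi)
  set B' := ∑ l ∈ Finset.range (L.natDegree + 1), ‖L.coeff l‖ * B
  obtain ⟨n, hn⟩ := pow_unbounded_of_one_lt (B' / ‖(m : ℂ) * L.eval (w i)‖) hgt
  rw [div_lt_iff₀' hpos] at hn
  have h2 : ‖(m : ℂ) * L.eval (w i)‖ * ‖w i‖ ^ (n + n₀) ≤ B' := by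
    rw [← norm_pow, ← norm_mul, hsum]
    refine (norm_sum_le _ _).trans (Finset.sum_le_sum fun l _ => ?_)
    rw [norm_mul]
    exact mul_le_mul_of_nonneg_left (h _ (by omega)) (norm_nonneg _)
  have h3 := mul_le_mul_of_nonneg_left
    (pow_le_pow_right₀ hgt.le (Nat.le_add_right n n₀)) hpos.le
  linarith

lemma exists_fin_enum {α : Type*} (m : Multiset α) {D : ℕ} (h : m.card = D) :
    ∃ γ : Fin D → α, Finset.univ.val.map γ = m := by
  obtain ⟨l, rfl⟩ : ∃ l : List α, (l : Multiset α) = m := ⟨m.toList, m.coe_toList⟩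
  obtain rfl : l.length = D := h
  exact ⟨l.get, by rw [Fin.univ_val_map, List.ofFn_get]⟩

/-- A sequence of finite support satisfying Newton's recursion consists of the elementary symmetric
functions of finitely many numbers. -/
lemma exists_reciprocal_roots {D : ℕ} {c S : ℕ → ℂ} (hc0 : c 0 = 1) (hcD : ∀ r, D < r → c r = 0)
    (hrec : ∀ r : ℕ, (r : ℂ) * c r = ∑ N ∈ Finset.range r, S (N + 1) * c (r - (N + 1))) :
    ∃ γ : Fin D → ℂ, (∀ N, ∑ i, γ i ^ (N + 1) = -S (N + 1)) ∧
      ∀ r, c r = (-1) ^ r * ∑ t ∈ Finset.powersetCard r Finset.univ, ∏ i ∈ t, γ i := by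
  set P : ℂ[X] := ∑ r ∈ Finset.range (D + 1), C (c r) * X ^ (D - r) with hP
  have hcoeff : ∀ r ≤ D, P.coeff (D - r) = c r := by
    intro r hr
    rw [hP, finsetSum_coeff, Finset.sum_eq_single r]
    · simp
    · intro r' hr' hne
      rw [Finset.mem_range] at hr'
      rw [coeff_C_mul_X_pow, if_neg (by omega)]
    · intro h
      exact absurd (Finset.mem_range.2 (by omega)) h
  have hdeg : P.natDegree = D := by
    refine natDegree_eq_of_le_of_coeff_ne_zero ?_ ?_
    · exact natDegree_sum_le_of_forall_le _ _ fun r _ =>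
        (natDegree_C_mul_X_pow_le _ _).trans (Nat.sub_le _ _)
    · have := hcoeff 0 (Nat.zero_le _)
      rw [Nat.sub_zero] at this
      rw [this, hc0]
      exact one_ne_zero
  have hlead : P.leadingCoeff = 1 := by
    rw [leadingCoeff, hdeg, ← hc0, ← hcoeff 0 (Nat.zero_le _), Nat.sub_zero]
  have hcard : P.roots.card = D := by
    rw [← (IsAlgClosed.splits P).natDegree_eq_card_roots, hdeg]
  obtain ⟨γ, hγ⟩ := exists_fin_enum P.roots hcard
  have hesymm : ∀ r, c r = (-1) ^ r * MvPolynomial.aeval γ (MvPolynomial.esymm (Fin D) ℂ r) := by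
    intro r
    rw [MvPolynomial.aeval_esymm_eq_multiset_esymm, hγ]
    rcases Nat.lt_or_ge D r with hr | hr
    · rw [hcD r hr, Multiset.esymm, Multiset.powersetCard_eq_empty r (by rw [hcard]; exact hr)]
      simp
    · rw [← hcoeff r hr, coeff_eq_esymm_roots_of_card (by rw [hcard, hdeg]) (by omega), hlead,
        hdeg, one_mul, Nat.sub_sub_self hr]
  refine ⟨γ, ?_, fun r => ?_⟩
  · intro N
    induction N using Nat.strong_induction_on with
    | _ N ih =>
      have h1 := congr_arg (MvPolynomial.aeval γ) (MvPolynomial.mul_esymm_eq_sum (Fin D) ℂ (N + 1))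
      have h2 := hrec (N + 1)
      rw [Finset.sum_filter, Finset.Nat.sum_antidiagonal_eq_sum_range_succ_mk,
        Finset.sum_range_succ, if_neg (lt_irrefl _), add_zero, ← Finset.sum_range_reflect] at h1
      simp only [map_mul, map_natCast, map_pow, map_neg, map_one, map_sum] at h1
      have h3 : ∑ M ∈ Finset.range (N + 1),
          (S (M + 1) + ∑ i, γ i ^ (M + 1)) * c (N + 1 - (M + 1)) = 0 := by
        simp only [add_mul]
        rw [Finset.sum_add_distrib, ← h2, hesymm, mul_left_comm, h1, ← mul_assoc, ← pow_add,
          Odd.neg_one_pow ⟨N + 1, by ring⟩, neg_one_mul, neg_add_eq_zero]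
        refine Finset.sum_congr rfl fun M hM => ?_
        have hM' := Finset.mem_range.1 hM
        rw [if_pos (by omega), show N + 1 - 1 - M = N + 1 - (M + 1) by omega,
          show N + 1 - (N + 1 - (M + 1)) = M + 1 by omega]
        simp only [map_mul, map_pow, map_neg, map_one, ← hesymm]
        simp [MvPolynomial.psum, mul_comm]
      rw [Finset.sum_range_succ, Finset.sum_eq_zero, zero_add, Nat.sub_self, hc0, mul_one] at h3
      · exact eq_neg_of_add_eq_zero_right h3
      · intro M hM
        rw [ih M (Finset.mem_range.1 hM), add_neg_cancel, zero_mul]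
  · rw [hesymm]
    simp [MvPolynomial.esymm]

lemma norm_esymm_le {D : ℕ} {γ : Fin D → ℂ} {x : ℝ} (h : ∀ i, ‖γ i‖ ≤ x) (r : ℕ) :
    ‖∑ t ∈ Finset.powersetCard r (Finset.univ : Finset (Fin D)), ∏ i ∈ t, γ i‖ ≤
      D.choose r * x ^ r := by
  refine (norm_sum_le_of_le (f := fun t => ∏ i ∈ t, γ i) (n := fun _ => x ^ r) _
    fun t ht => ?_).trans_eq ?_
  · rw [norm_prod]
    refine (Finset.prod_le_prod (fun i _ => norm_nonneg _) fun i _ => h i).trans_eq ?_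
    rw [Finset.prod_const, (Finset.mem_powersetCard.1 ht).2]
  · simp

end PowerSums

section Orthogonality

variable {F : Type*} [Field F] [Fintype F]

lemma sum_mulChar [Fintype (MulChar F ℂ)] [DecidableEq F] (u : F) :
    ∑ lam : MulChar F ℂ, lam u = if u = 1 then (Fintype.card F : ℂ) - 1 else 0 := by
  split_ifs with h
  · subst h
    have hcard : Fintype.card (MulChar F ℂ) = Fintype.card F - 1 := by
      rw [← Nat.card_eq_fintype_card, MulChar.card_eq_card_units_of_hasEnoughRootsOfUnity,
        Nat.card_eq_fintype_card, Fintype.card_units]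
    simp [hcard, Nat.cast_sub Fintype.card_pos]
  · obtain ⟨lam, hlam⟩ := MulChar.exists_apply_ne_one_of_hasEnoughRootsOfUnity F ℂ h
    refine eq_zero_of_mul_eq_self_left hlam ?_
    simp only [Finset.mul_sum, ← MulChar.mul_apply]
    exact Fintype.sum_bijective _ (Group.mulLeft_bijective lam) _ _ fun _ => rfl

lemma sum_addChar_units [DecidableEq F] {ψ : AddChar F ℂ} (hψ : ψ.IsPrimitive) (v : F) :
    ∑ a : Fˣ, ψ (a * v) = (if v = 0 then (Fintype.card F : ℂ) else 0) - 1 := by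
  have h := AddChar.sum_mulShift v hψ
  have h2 : ∑ a : Fˣ, ψ (a * v) = ∑ a ∈ Finset.univ.erase (0 : F), ψ (a * v) :=
    Finset.sum_bij (fun a _ => (a : F)) (fun a _ => by simp) (fun a _ b _ h => Units.ext h)
      (fun a ha => ⟨Units.mk0 a (by simpa using ha), Finset.mem_univ _, rfl⟩) fun _ _ => rfl
  rw [h2, Finset.sum_erase_eq_sub (Finset.mem_univ _), h]
  simp

end Orthogonality

section PrimeSums

lemma laurentEval_smul {F K : Type*} [Field F] [Field K] [Algebra F K] {k : ℕ} {b : Fin k → ℤ}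
    {t : Fin k → F} (a : F) (x : K) :
    laurentEval b (algebraMap F K ∘ (a • t)) x =
      algebraMap F K a * laurentEval b (algebraMap F K ∘ t) x := by
  simp [laurentEval, Finset.mul_sum, mul_assoc]

variable {F K : Type*} [Field F] [Fintype F] [Field K] [Algebra F K] {N : ℕ} {x : K}

lemma conjugates_eq : conjugates F N x =
    (Multiset.range N).map fun i => x ^ Fintype.card F ^ i := by
  simp only [conjugates, orbitMultiset, iterate_frobenius]

lemma algebraMap_norm_conjPoly (hx : x ^ Fintype.card F ^ N = x) :
    algebraMap F K ((-1) ^ N * (conjPoly F N x).coeff 0) =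
      x ^ ∑ i ∈ Finset.range N, Fintype.card F ^ i := by
  have h : (conjugates F N x).card = N := by rw [conjugates, card_orbitMultiset]
  have h2 : (((conjugates F N x).map fun a => X - C a).prod).coeff 0 =
      (-1) ^ N * (conjugates F N x).prod := by
    rw [coeff_zero_multiset_prod, Multiset.map_map]
    simp [Multiset.prod_map_neg, h]
  rw [map_mul, ← coeff_map, map_conjPoly hx, h2, map_pow, map_neg, map_one, ← mul_assoc,
    ← mul_pow, neg_one_mul, neg_neg, one_pow, one_mul, conjugates_eq]
  exact Finset.prod_pow_eq_pow_sum (Finset.range N) (fun i => Fintype.card F ^ i) x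

variable {k : ℕ} {b : Fin k → ℤ} {t : Fin k → F}

lemma sum_laurentEval_conjugates
    (p : ℕ) [Fact p.Prime] [CharP F p] [CharP K p] (N : ℕ) (x : K) :
    ((conjugates F N x).map (laurentEval b (algebraMap F K ∘ t))).sum =
      frobSum (Fintype.card F) N (laurentEval b (algebraMap F K ∘ t) x) := by
  obtain ⟨e, -, he⟩ := FiniteField.card F p
  rw [conjugates_eq, Multiset.map_map]
  exact Finset.sum_congr (s₁ := Finset.range N) rfl fun i _ =>
    (laurentEval_pow_card_pow (b := b) (t := t) he x i).symm

variable [IsAlgClosed K]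

lemma traceChar_conjPoly (p : ℕ) [Fact p.Prime] [CharP F p] [CharP K p]
    {ψ : AddChar F ℂ} {lam : MulChar F ℂ} {s : K →ₗ[F] F} (a : F)
    (hx : x ^ Fintype.card F ^ N = x) :
    traceChar ψ lam s (laurentEval b (algebraMap F K ∘ (a • t))) (conjPoly F N x) =
      lam ((-1) ^ N * (conjPoly F N x).coeff 0) *
        ψ (a * s (frobSum (Fintype.card F) N (laurentEval b (algebraMap F K ∘ t) x))) := by
  rw [traceChar_apply, natDegree_conjPoly hx, aroots_conjPoly hx,
    ← sum_laurentEval_conjugates p, Multiset.map_congr rfl fun y _ => laurentEval_smul a y,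
    Multiset.sum_map_mul_left, ← Algebra.smul_def, map_smul, smul_eq_mul]

/-- The norm-one elements are the `(q - 1)`-st powers. -/
lemma card_filter_pow_card_sub_one [DecidableEq K] (hN : 0 < N) (P : K → Prop) [DecidablePred P] :
    ((cyclicUnits F K N).filter fun z => P (z ^ (Fintype.card F - 1))).card =
      (Fintype.card F - 1) * ((cyclicUnits F K N).filter fun x =>
        x ^ ∑ i ∈ Finset.range N, Fintype.card F ^ i = 1 ∧ P x).card := by
  have hq : 2 ≤ Fintype.card F := Fintype.one_lt_card
  have hgeom : (Fintype.card F - 1) * ∑ i ∈ Finset.range N, Fintype.card F ^ i =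
      Fintype.card F ^ N - 1 := by
    rw [Nat.geomSum_eq hq, Nat.mul_div_cancel' (by simpa using Nat.sub_one_dvd_pow_sub_one _ N)]
  have hpos : 0 < Fintype.card F ^ N - 1 := Nat.sub_pos_of_lt (Nat.one_lt_pow hN.ne' hq)
  have hmem : ∀ z : K, z ∈ cyclicUnits F K N ↔ z ^ (Fintype.card F ^ N - 1) = 1 :=
    fun z => mem_nthRootsFinset hpos _
  rw [Finset.card_eq_sum_card_fiberwise (f := fun z => z ^ (Fintype.card F - 1))
    (t := (cyclicUnits F K N).filter fun x =>
      x ^ ∑ i ∈ Finset.range N, Fintype.card F ^ i = 1 ∧ P x)]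
  · rw [Finset.sum_const_nat (m := Fintype.card F - 1), mul_comm]
    intro x hx
    obtain ⟨hx1, hx2, hx3⟩ := Finset.mem_filter.1 hx
    rw [hmem] at hx1
    have hx0 : x ≠ 0 := by
      rintro rfl
      rw [zero_pow hpos.ne'] at hx1
      exact zero_ne_one hx1
    have hq0 : ((Fintype.card F - 1 : ℕ) : K) ≠ 0 := by
      simpa using card_sub_one_cast_ne_zero (F := F) (K := K) one_pos
    refine Eq.trans (congr_arg Finset.card ?_) (card_nthRootsFinset_of_isAlgClosed hq0 hx0)
    ext z
    rw [Finset.mem_filter, Finset.mem_filter, hmem, mem_nthRootsFinset (by omega)]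
    refine ⟨fun h => h.2, fun h => ⟨⟨?_, ?_⟩, h⟩⟩
    · rw [← hgeom, pow_mul, h, hx2]
    · rwa [h]
  · intro z hz
    rw [Finset.mem_coe, Finset.mem_filter, hmem] at hz
    rw [Finset.mem_coe, Finset.mem_filter, hmem, ← pow_mul, ← pow_mul, hgeom, mul_comm, pow_mul,
      hz.1, one_pow]
    exact ⟨rfl, rfl, hz.2⟩

lemma sum_primeSum (p : ℕ) [Fact p.Prime] [CharP F p] [CharP K p]
    [Fintype (MulChar F ℂ)] [DecidableEq F] [DecidableEq K] {ψ : AddChar F ℂ} (hψ : ψ.IsPrimitive)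
    {s : K →ₗ[F] F} (hs : ∀ x, s (algebraMap F K x) = x) (hN : 0 < N) :
    ∑ lam : MulChar F ℂ, ∑ a : Fˣ,
      primeSum K (traceChar ψ lam s (laurentEval b (algebraMap F K ∘ ((a : F) • t)))) N =
        Fintype.card F * (traceFiber F b (algebraMap F K ∘ t) N 0).card -
          ((Fintype.card F : ℂ) ^ N - 1) := by
  classical
  set g := laurentEval b (algebraMap F K ∘ t) with hg
  have hq : 1 ≤ Fintype.card F := Fintype.card_pos
  obtain ⟨e, -, he⟩ := FiniteField.card F p
  have h1 : ∀ x ∈ cyclicUnits F K N, ∑ lam : MulChar F ℂ, ∑ a : Fˣ,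
      traceChar ψ lam s (laurentEval b (algebraMap F K ∘ ((a : F) • t))) (conjPoly F N x) =
      (if x ^ ∑ i ∈ Finset.range N, Fintype.card F ^ i = 1 then (Fintype.card F : ℂ) - 1 else 0) *
      ((if frobSum (Fintype.card F) N (g x) = 0 then (Fintype.card F : ℂ) else 0) - 1) := by
    intro x hx
    have hx' := ((mem_cyclicUnits hN).1 hx).2
    have hu : (-1) ^ N * (conjPoly F N x).coeff 0 = 1 ↔
        x ^ ∑ i ∈ Finset.range N, Fintype.card F ^ i = 1 := by
      rw [← algebraMap_norm_conjPoly hx', map_eq_one_iff _ (algebraMap F K).injective]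
    have hv : s (frobSum (Fintype.card F) N (g x)) = 0 ↔
        frobSum (Fintype.card F) N (g x) = 0 := by
      have hgx : g x ^ Fintype.card F ^ N = g x := by
        rw [hg]
        exact (laurentEval_pow_card_pow he x N).trans (by rw [hx'])
      have : CharP K (ringChar F) := by
        rw [ringChar.eq F p]
        exact ‹CharP K p›
      obtain ⟨c, hc⟩ := frobSum_mem_range (F := F) hgx
      rw [← hc, hs, map_eq_zero]
    simp only [traceChar_conjPoly p _ hx', ← Finset.mul_sum, sum_addChar_units hψ,
      ← Finset.sum_mul, sum_mulChar, hu, ← hg, hv]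
  have h2 := card_filter_pow_card_sub_one (F := F) (K := K) hN fun _ => True
  have h3 := card_filter_pow_card_sub_one (F := F) (K := K) hN
    fun x => frobSum (Fintype.card F) N (g x) = 0
  simp only [and_true, Finset.filter_true, card_cyclicUnits hN] at h2
  have h2' := congr_arg (Nat.cast : ℕ → ℂ) h2
  have h3' := congr_arg (Nat.cast : ℕ → ℂ) h3
  push_cast [Nat.cast_sub (Nat.one_le_pow N _ hq), Nat.cast_sub hq] at h2' h3'
  simp only [primeSum]
  rw [Finset.sum_congr rfl fun lam _ => Finset.sum_comm, Finset.sum_comm, Finset.sum_congr rfl h1]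
  rw [traceFiber, h3', h2', ← Finset.filter_filter, Finset.card_filter, Finset.card_filter,
    Finset.sum_filter]
  push_cast
  simp only [Finset.mul_sum]
  rw [← Finset.sum_sub_distrib]
  refine Finset.sum_congr rfl fun x _ => ?_
  split_ifs <;> ring

/-- The Riemann hypothesis for the `L`-functions of the characters `traceChar`, in the form of a
bound for their coefficients. -/
theorem norm_monicSum_traceChar_le (p : ℕ) [Fact p.Prime] [CharP F p] [CharP K p]
    {ψ : AddChar F ℂ} (hψ : ψ.IsPrimitive)
    {s : K →ₗ[F] F} (hs : ∀ x, s (algebraMap F K x) = x) (hb : b.Injective)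
    (hbp : ∀ i, ¬ (p : ℤ) ∣ b i) (ht : t ≠ 0) {l m : ℕ} (hl : ∀ i, b i ≤ l)
    (hm : ∀ i, -(m : ℤ) ≤ b i) (lam : MulChar F ℂ) (r : ℕ) :
    ‖monicSum (traceChar ψ lam s (laurentEval b (algebraMap F K ∘ t))) r‖ ≤
      (l + m).choose r * √(Fintype.card F : ℝ) ^ r := by
  classical
  have := Fintype.ofFinite (MulChar F ℂ)
  have hq : (0 : ℝ) < Fintype.card F := by exact_mod_cast Fintype.card_pos
  set χ : MulChar F ℂ → Fˣ → F[X] →* ℂ := fun lam a =>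
    traceChar ψ lam s (laurentEval b (algebraMap F K ∘ ((a : F) • t))) with hχ
  have hex : ∀ lam a, ∃ γ : Fin (l + m) → ℂ, (∀ N, ∑ i, γ i ^ (N + 1) =
      -primeSum K (χ lam a) (N + 1)) ∧ ∀ r, monicSum (χ lam a) r =
        (-1) ^ r * ∑ t ∈ Finset.powersetCard r Finset.univ, ∏ i ∈ t, γ i := fun lam a =>
    exists_reciprocal_roots (monicSum_zero _)
      (fun r hr => monicSum_traceChar_eq_zero p hψ hs hb hbp (smul_ne_zero a.ne_zero ht) hl hm hr)
      (monicSum_newton K fun f hf => traceChar_eq_zero hf)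
  choose γ hγ1 hγ2 using hex
  obtain ⟨B, α₀, hB⟩ := exists_abs_card_traceFiber_le (K := K) hb hbp ht
  have hw := norm_le_one_of_powerSum_bounded
    (fun i : MulChar F ℂ × Fˣ × Fin (l + m) => γ i.1 i.2.1 i.2.2 ^ 2 / (Fintype.card F : ℂ))
    (B := B) (n₀ := α₀ + 1) (by
      intro α hα
      obtain ⟨N, hN⟩ : ∃ N, 2 * α = N + 1 := ⟨2 * α - 1, by omega⟩
      have h1 : ∑ i : MulChar F ℂ × Fˣ × Fin (l + m),
          (γ i.1 i.2.1 i.2.2 ^ 2 / (Fintype.card F : ℂ)) ^ α =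
          -(∑ lam : MulChar F ℂ, ∑ a : Fˣ, primeSum K (χ lam a) (2 * α)) /
            (Fintype.card F : ℂ) ^ α := by
        simp only [Fintype.sum_prod_type, div_pow, ← pow_mul, ← Finset.sum_div, hN, hγ1,
          Finset.sum_neg_distrib]
      rw [h1, sum_primeSum p hψ hs (by omega), norm_div, norm_neg, norm_pow,
        Complex.norm_natCast, div_le_iff₀ (by positivity)]
      refine le_trans (le_of_eq ?_) (hB α (by omega))
      rw [← Real.norm_eq_abs, ← Complex.norm_real]
      push_cast
      rfl)
  have hγ : ∀ i, ‖γ lam 1 i‖ ≤ √(Fintype.card F : ℝ) := by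
    intro i
    have h := hw (lam, 1, i)
    rw [norm_div, norm_pow, Complex.norm_natCast, div_le_one hq] at h
    exact Real.le_sqrt_of_sq_le h
  have h1 := hγ2 lam 1 r
  simp only [hχ, Units.val_one, one_smul] at h1
  rw [h1, norm_mul, norm_pow, norm_neg, norm_one, one_pow, one_mul]
  exact norm_esymm_le hγ r

end PrimeSums

section Majorant

/-- The coefficients of `∏ (1 + √q u / q ^ i)` over `i ≥ 1`. -/
noncomputable def eulerCoeff (q : ℝ) : ℕ → ℝ
  | 0 => 1
  | m + 1 => √q * eulerCoeff q m / (q ^ (m + 1) - 1)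

variable {q : ℝ}

lemma eulerCoeff_nonneg (hq : 1 < q) (m : ℕ) : 0 ≤ eulerCoeff q m := by
  induction m with
  | zero => simp [eulerCoeff]
  | succ m ih =>
    have : 1 < q ^ (m + 1) := one_lt_pow₀ hq (by omega)
    rw [eulerCoeff]
    exact div_nonneg (mul_nonneg (Real.sqrt_nonneg _) ih) (by linarith)

lemma eulerCoeff_le (hq : 1 < q) (m : ℕ) :
    eulerCoeff q m ≤ q ^ (-(m : ℝ) ^ 2 / 2) * (1 + 1 / (q - 1)) ^ m := by
  have hq0 : 0 < q := by linarith
  induction m with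
  | zero => simp [eulerCoeff]
  | succ m ih =>
    have h1 : 1 < q ^ (m + 1) := one_lt_pow₀ hq (by omega)
    have h2 : √q / (q ^ (m + 1) - 1) ≤ q ^ (-(m : ℝ) - 1 / 2) * (1 + 1 / (q - 1)) := by
      have h3 : q ^ (-(m : ℝ) - 1 / 2) = √q / q ^ (m + 1) := by
        rw [Real.sqrt_eq_rpow, ← Real.rpow_natCast, ← Real.rpow_sub hq0]
        congr 1
        push_cast
        ring
      have h4 : 1 + 1 / (q - 1) = q / (q - 1) := by
        have : q - 1 ≠ 0 := by linarith
        field_simp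
        ring
      rw [h3, h4, div_mul_div_comm, div_le_div_iff₀ (by linarith) (by
        have : 0 < q - 1 := by linarith
        positivity), mul_assoc]
      refine mul_le_mul_of_nonneg_left ?_ (Real.sqrt_nonneg _)
      have : q ≤ q ^ (m + 1) := le_self_pow₀ hq.le (by omega)
      nlinarith
    rw [eulerCoeff, mul_div_right_comm]
    calc √q / (q ^ (m + 1) - 1) * eulerCoeff q m
        ≤ (q ^ (-(m : ℝ) - 1 / 2) * (1 + 1 / (q - 1))) *
          (q ^ (-(m : ℝ) ^ 2 / 2) * (1 + 1 / (q - 1)) ^ m) :=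
          mul_le_mul h2 ih (eulerCoeff_nonneg hq m) (by
            have : 0 < q - 1 := by linarith
            positivity)
      _ = _ := by
          rw [mul_mul_mul_comm, ← Real.rpow_add hq0, pow_succ' (1 + 1 / (q - 1))]
          congr 2
          push_cast
          ring

/-- The power series `∏ (1 + √q u / q ^ i)` over `i ≥ 1`. -/
noncomputable def eulerSeries (q : ℝ) : PowerSeries ℝ := PowerSeries.mk (eulerCoeff q)

lemma rescale_eulerSeries (hq : 1 < q) :
    PowerSeries.rescale q (eulerSeries q) =
      (((1 + Polynomial.C √q * Polynomial.X : Polynomial ℝ)) : PowerSeries ℝ) * eulerSeries q := by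
  ext n
  rw [Polynomial.coe_add, Polynomial.coe_mul, Polynomial.coe_C, Polynomial.coe_X,
    Polynomial.coe_one, add_mul, one_mul, map_add, mul_assoc, PowerSeries.coeff_C_mul,
    PowerSeries.coeff_rescale]
  rcases n with _ | n
  · simp
  · rw [PowerSeries.coeff_succ_X_mul, eulerSeries, PowerSeries.coeff_mk, PowerSeries.coeff_mk]
    have h1 : 1 < q ^ (n + 1) := one_lt_pow₀ hq (by omega)
    have h2 : q ^ (n + 1) - 1 ≠ 0 := by linarith
    rw [eulerCoeff]
    field_simp
    ring

lemma coeff_one_add_C_mul_X_pow (s : ℝ) (D r : ℕ) :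
    ((1 + Polynomial.C s * Polynomial.X : Polynomial ℝ) ^ D).coeff r =
      (D.choose r : ℝ) * s ^ r := by
  have h : (1 + Polynomial.C s * Polynomial.X : Polynomial ℝ) ^ D =
      ((1 + Polynomial.X : Polynomial ℝ) ^ D).comp (Polynomial.C s * Polynomial.X) := by simp
  rw [h, Polynomial.comp_C_mul_X_coeff, Polynomial.coeff_one_add_X_pow]

lemma coeff_eulerSeries_pow_recursion (hq : 1 < q) (D n : ℕ) :
    q ^ n * PowerSeries.coeff n (eulerSeries q ^ D) = ∑ r ∈ Finset.range (n + 1),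
      (D.choose r : ℝ) * √q ^ r * PowerSeries.coeff (n - r) (eulerSeries q ^ D) := by
  have h := congr_arg (PowerSeries.coeff n) (congr_arg (· ^ D) (rescale_eulerSeries hq))
  simp only [mul_pow, ← map_pow, ← Polynomial.coe_pow] at h
  rw [PowerSeries.coeff_rescale, PowerSeries.coeff_mul,
    Finset.Nat.sum_antidiagonal_eq_sum_range_succ_mk] at h
  simpa only [Polynomial.coeff_coe, coeff_one_add_C_mul_X_pow] using h

lemma coeff_eulerSeries_pow_le (hq : 1 < q) (D n : ℕ) :
    PowerSeries.coeff n (eulerSeries q ^ (D + 1)) ≤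
      q ^ (-(n : ℝ) ^ 2 / (2 * (D + 1 : ℕ))) * (1 + 1 / (q - 1)) ^ n * ((n + D).choose D : ℝ) := by
  have hq0 : 0 < q := by linarith
  have hq1 : 0 < q - 1 := by linarith
  induction D generalizing n with
  | zero =>
    simpa [eulerSeries] using eulerCoeff_le hq n
  | succ D ih =>
    rw [pow_succ, PowerSeries.coeff_mul]
    have hstep : ∀ x ∈ Finset.HasAntidiagonal.antidiagonal n,
        PowerSeries.coeff x.1 (eulerSeries q ^ (D + 1)) * PowerSeries.coeff x.2 (eulerSeries q) ≤
        q ^ (-(n : ℝ) ^ 2 / (2 * (D + 1 + 1 : ℕ))) * (1 + 1 / (q - 1)) ^ n *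
          ((x.1 + D).choose D : ℝ) := by
      rintro ⟨i, j⟩ hx
      rw [Finset.HasAntidiagonal.mem_antidiagonal] at hx
      simp only at hx ⊢
      have hj := eulerCoeff_le hq j
      rw [show PowerSeries.coeff j (eulerSeries q) = eulerCoeff q j from
        PowerSeries.coeff_mk _ _]
      refine (mul_le_mul (ih i) hj (eulerCoeff_nonneg hq j) (by positivity)).trans ?_
      have he : -(i : ℝ) ^ 2 / (2 * (D + 1 : ℕ)) + -(j : ℝ) ^ 2 / 2 ≤
          -(n : ℝ) ^ 2 / (2 * (D + 1 + 1 : ℕ)) := by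
        rw [← hx]
        push_cast
        have hD : (0 : ℝ) < D + 1 := by positivity
        rw [div_add_div _ _ (by positivity) (by norm_num), div_le_div_iff₀ (by positivity)
          (by positivity)]
        nlinarith [mul_nonneg hD.le (sq_nonneg ((i : ℝ) - (D + 1) * j)),
          sq_nonneg ((i : ℝ) - (D + 1) * j)]
      calc _ = q ^ (-(i : ℝ) ^ 2 / (2 * (D + 1 : ℕ)) + -(j : ℝ) ^ 2 / 2) *
            (1 + 1 / (q - 1)) ^ n * ((i + D).choose D : ℝ) := by
            rw [Real.rpow_add hq0, ← hx, pow_add]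
            ring
        _ ≤ _ := by
            have := Real.rpow_le_rpow_of_exponent_le hq.le he
            gcongr
    refine (Finset.sum_le_sum hstep).trans_eq ?_
    rw [← Finset.mul_sum, Finset.Nat.sum_antidiagonal_eq_sum_range_succ_mk]
    congr 1
    have := Nat.sum_range_add_choose n D
    rw [← add_assoc, ← this]
    push_cast
    rfl

theorem norm_le_of_recursion (hq : 1 < q) {d : ℕ} (hd : 1 ≤ d) {a c : ℕ → ℂ} (ha : a 0 = 1)
    (hc0 : c 0 = 1) (hc : ∀ r, ‖c r‖ ≤ d.choose r * √q ^ r)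
    (h : ∀ n, (q : ℂ) ^ n * a n = ∑ r ∈ Finset.range (n + 1), c r * a (n - r)) (n : ℕ) :
    ‖a n‖ ≤ q ^ (-(n : ℝ) ^ 2 / (2 * (d : ℝ))) * (1 + 1 / (q - 1)) ^ n *
      ((n + d).choose n : ℝ) := by
  have hq0 : 0 < q := by linarith
  have hq1 : 0 < q - 1 := by linarith
  have hmaj : ∀ n, ‖a n‖ ≤ PowerSeries.coeff n (eulerSeries q ^ d) := by
    intro n
    induction n using Nat.strong_induction_on with
    | _ n ih =>
      have hrec := coeff_eulerSeries_pow_recursion hq d n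
      have h' := h n
      rw [Finset.sum_range_succ'] at hrec h'
      simp only [Nat.choose_zero_right, pow_zero, Nat.sub_zero, hc0, one_mul, Nat.cast_one]
        at hrec h'
      rcases Nat.eq_zero_or_pos n with rfl | hn
      · simp [ha, eulerSeries, eulerCoeff]
      have h1 : 1 < q ^ n := one_lt_pow₀ hq hn.ne'
      have h3 : ((q : ℂ) ^ n - 1) * a n = ∑ k ∈ Finset.range n, c (k + 1) * a (n - (k + 1)) := by
        rw [sub_mul, h']; ring
      have h4 : ‖(q : ℂ) ^ n - 1‖ = q ^ n - 1 := by
        rw [show (q : ℂ) ^ n - 1 = ((q ^ n - 1 : ℝ) : ℂ) by push_cast; rfl, Complex.norm_real,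
          Real.norm_of_nonneg (by linarith)]
      have h5 : (q ^ n - 1) * ‖a n‖ ≤ (q ^ n - 1) * PowerSeries.coeff n (eulerSeries q ^ d) := by
        rw [← h4, ← norm_mul, h3, h4, sub_mul, hrec]
        refine (norm_sum_le _ _).trans ?_
        rw [one_mul, add_sub_cancel_right]
        refine Finset.sum_le_sum fun k hk => ?_
        rw [norm_mul]
        have := Finset.mem_range.1 hk
        exact mul_le_mul (hc _) (ih _ (by omega)) (norm_nonneg _) (by positivity)
      exact le_of_mul_le_mul_left h5 (by linarith)
  obtain ⟨D, rfl⟩ : ∃ D, d = D + 1 := ⟨d - 1, by omega⟩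
  refine (hmaj n).trans ((coeff_eulerSeries_pow_le hq D n).trans ?_)
  refine mul_le_mul_of_nonneg_left ?_ (by positivity)
  rw [Nat.choose_symm_add]
  norm_cast
  rw [← add_assoc, Nat.choose_succ_succ]
  exact Nat.le_add_right _ _

end Majorant

section PowerTraces

variable {n : ℕ} {K : Type*} [Field K] [IsAlgClosed K]

lemma det_aeval_eq_prod_roots_charpoly (A : Matrix (Fin n) (Fin n) K) (f : K[X]) :
    (aeval A f).det = (A.charpoly.roots.map fun x => f.eval x).prod := by
  have hcard : A.charpoly.roots.card = n := by
    rw [← (IsAlgClosed.splits _).natDegree_eq_card_roots, Matrix.charpoly_natDegree_eq_dim,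
      Fintype.card_fin]
  have hlin : ∀ a : K, (aeval A (X - C a)).det = (A.charpoly.roots.map fun x => x - a).prod := by
    intro a
    have h1 : A.charpoly.eval a = (A.charpoly.roots.map fun x => a - x).prod := by
      conv_lhs => rw [(IsAlgClosed.splits A.charpoly).eq_prod_roots_of_monic A.charpoly_monic]
      rw [eval_multiset_prod, Multiset.map_map]
      simp
    have h2 : aeval A (X - C a) = -(Matrix.scalar (Fin n) a - A) := by
      simp [Matrix.algebraMap_eq_diagonal, Pi.algebraMap_def]
    have h3 : ∀ m : Multiset K, (m.map fun x => x - a).prod =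
        (-1) ^ m.card * (m.map fun x => a - x).prod := by
      intro m
      simpa using Multiset.prod_map_neg (m.map fun x => a - x)
    rw [h2, Matrix.det_neg, ← Matrix.eval_charpoly, h1, h3, hcard, Fintype.card_fin]
  have hprod : ∀ m : Multiset K, (aeval A (m.map fun a => X - C a).prod).det =
      (A.charpoly.roots.map fun x => ((m.map fun a => X - C a).prod).eval x).prod := by
    intro m
    induction m using Multiset.induction with
    | empty => simp
    | cons a m ih =>
      rw [Multiset.map_cons, Multiset.prod_cons, map_mul, Matrix.det_mul, ih, hlin,
        ← Multiset.prod_map_mul]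
      simp
  rw [(IsAlgClosed.splits f).eq_prod_roots, map_mul, aeval_C, Matrix.det_mul, hprod]
  simp only [eval_mul, eval_C, Multiset.prod_map_mul, Multiset.map_const', Multiset.prod_replicate,
    hcard]
  congr 1
  rw [Algebra.algebraMap_eq_smul_one, Matrix.det_smul, Matrix.det_one, mul_one, Fintype.card_fin]

lemma roots_charpoly_of_aeval_mul_eq {A B : Matrix (Fin n) (Fin n) K} {f h : K[X]}
    (hh : ∀ x ∈ A.charpoly.roots, h.eval x ≠ 0) (hB : aeval A h * B = aeval A f) :
    B.charpoly.roots = A.charpoly.roots.map fun x => f.eval x / h.eval x := by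
  suffices B.charpoly =
      ((A.charpoly.roots.map fun x => f.eval x / h.eval x).map fun a => X - C a).prod by
    rw [this, roots_multiset_prod_X_sub_C]
  refine Polynomial.funext fun y => ?_
  have hdet := det_aeval_eq_prod_roots_charpoly A h
  have h0 : (aeval A h).det ≠ 0 := by
    rw [hdet]
    exact Multiset.prod_ne_zero fun h0 => by
      obtain ⟨x, hx, hx0⟩ := Multiset.mem_map.1 h0
      exact hh x hx hx0
  have h1 : aeval A h * (Matrix.scalar (Fin n) y - B) = aeval A (C y * h - f) := by
    rw [mul_sub, hB, map_sub, map_mul, aeval_C, Algebra.commutes]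
    rfl
  refine mul_left_cancel₀ h0 ?_
  rw [Matrix.eval_charpoly, ← Matrix.det_mul, h1, det_aeval_eq_prod_roots_charpoly, hdet,
    eval_multiset_prod, Multiset.map_map, Multiset.map_map, ← Multiset.prod_map_mul]
  refine congr_arg _ (Multiset.map_congr rfl fun x hx => ?_)
  have := hh x hx
  simp
  field_simp

variable {F : Type*} [Field F] [Algebra F K]

/-- The traces of the integral powers of an invertible matrix are the power sums of its
eigenvalues. -/
lemma powerSum_aroots_charpoly (M : GL (Fin n) F) (j : ℤ) :
    powerSum ((M : Matrix (Fin n) (Fin n) F).charpoly.aroots K) j =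
      algebraMap F K ((M ^ j : GL (Fin n) F) : Matrix (Fin n) (Fin n) F).trace := by
  set φ : Matrix (Fin n) (Fin n) F →+* Matrix (Fin n) (Fin n) K := (algebraMap F K).mapMatrix
    with hφ
  set A := φ M with hA
  have hroots : (M : Matrix (Fin n) (Fin n) F).charpoly.aroots K = A.charpoly.roots := by
    rw [aroots, hA, hφ, RingHom.mapMatrix_apply, Matrix.charpoly_map]
  have hne : ∀ x ∈ A.charpoly.roots, x ≠ 0 := by
    rintro x hx rfl
    have hdet : A.det = 0 := by
      rw [Matrix.det_eq_prod_roots_charpoly]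
      exact Multiset.prod_eq_zero hx
    have hdet' : A.det = algebraMap F K (M : Matrix (Fin n) (Fin n) F).det :=
      ((algebraMap F K).map_det _).symm
    rw [hdet', map_eq_zero] at hdet
    exact ((Matrix.isUnit_iff_isUnit_det _).1 M.isUnit).ne_zero hdet
  have key : ∀ N : Matrix (Fin n) (Fin n) F, (φ N).charpoly.roots = A.charpoly.roots.map (· ^ j) →
      powerSum A.charpoly.roots j = algebraMap F K N.trace := by
    intro N hN
    have h1 : (φ N).trace = algebraMap F K N.trace := by
      simp [hφ, Matrix.trace]
    rw [powerSum, ← hN, ← Matrix.trace_eq_sum_roots_charpoly, h1]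
  rw [hroots]
  refine key _ ?_
  obtain ⟨m, rfl | rfl⟩ := j.eq_nat_or_neg
  · rw [roots_charpoly_of_aeval_mul_eq (A := A) (f := X ^ m) (h := 1) (by simp)]
    · simp
    · simp [hA]
  · rw [roots_charpoly_of_aeval_mul_eq (A := A) (f := 1) (h := X ^ m)]
    · simp
    · intro x hx
      simpa using fun h => absurd h (hne x hx)
    · rw [map_pow, aeval_X, map_one, hA, ← map_pow, ← map_mul, ← Units.val_pow_eq_pow_val,
        ← Units.val_mul, zpow_neg, zpow_natCast, mul_inv_cancel, Units.val_one, map_one]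

lemma traceChar_charpoly {ψ : AddChar F ℂ} {lam : MulChar F ℂ} {s : K →ₗ[F] F}
    (hs : ∀ x, s (algebraMap F K x) = x) {k : ℕ} (b : Fin k → ℤ) (t : Fin k → F)
    (M : GL (Fin n) F) :
    traceChar ψ lam s (laurentEval b (algebraMap F K ∘ t))
      (M : Matrix (Fin n) (Fin n) F).charpoly = lam (M : Matrix (Fin n) (Fin n) F).det *
        ψ (∑ i, t i * ((M ^ b i : GL (Fin n) F) : Matrix (Fin n) (Fin n) F).trace) := by
  rw [traceChar_apply, Matrix.charpoly_natDegree_eq_dim, ← Matrix.det_eq_sign_charpoly_coeff,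
    sum_map_laurentEval]
  simp only [powerSum_aroots_charpoly, Function.comp_apply, ← map_mul, ← map_sum, hs]

lemma traceChar_charpoly_eq_zero {ψ : AddChar F ℂ} {lam : MulChar F ℂ} {s : K →ₗ[F] F} {g : K → K}
    {M : Matrix (Fin n) (Fin n) F} (hM : M.det = 0) : traceChar ψ lam s g M.charpoly = 0 := by
  rw [traceChar_apply, Matrix.charpoly_natDegree_eq_dim, ← Matrix.det_eq_sign_charpoly_coeff, hM,
    MulChar.map_zero, zero_mul]

end PowerTraces

open Matrix

section LinearGroupMeans

variable {F : Type*} [Field F] [Fintype F] [DecidableEq F] {n : ℕ}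

lemma matrixMean_eq_sum_GL {χ : F[X] →* ℂ}
    (hχ : ∀ M : Matrix (Fin n) (Fin n) F, M.det = 0 → χ M.charpoly = 0) :
    matrixMean χ n = (∑ M : GL (Fin n) F, χ (M : Matrix (Fin n) (Fin n) F).charpoly) /
      (Nat.card (GL (Fin n) F) : ℂ) := by
  rw [matrixMean]
  congr 1
  refine (Finset.sum_of_injOn (fun M : GL (Fin n) F => (M : Matrix (Fin n) (Fin n) F))
    (Units.val_injective.injOn) (fun _ _ => Finset.mem_coe.2 (Finset.mem_univ _))
    (fun M _ hM => hχ M ?_) fun _ _ => rfl).symm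
  by_contra hdet
  exact hM ⟨GeneralLinearGroup.mkOfDetNeZero M hdet, by simp, rfl⟩

lemma sum_mulChar_det_eq_zero (hn : n ≠ 0) {lam : MulChar F ℂ} (hlam : lam ≠ 1) :
    ∑ M : GL (Fin n) F, lam (M : Matrix (Fin n) (Fin n) F).det = 0 := by
  obtain ⟨u, hu⟩ := MulChar.ne_one_iff.1 hlam
  have : Nonempty (Fin n) := ⟨⟨0, Nat.pos_of_ne_zero hn⟩⟩
  obtain ⟨N, hN⟩ := GeneralLinearGroup.det_surjective (n := Fin n) u
  have hN' : (N : Matrix (Fin n) (Fin n) F).det = u := by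
    rw [← hN, GeneralLinearGroup.val_det_apply]
  refine eq_zero_of_mul_eq_self_left hu ?_
  rw [Finset.mul_sum]
  refine Fintype.sum_bijective _ (Group.mulLeft_bijective N) _ _ fun M => ?_
  rw [Units.val_mul, det_mul, map_mul, hN']

lemma sum_mulChar_det_mul [Fintype (MulChar F ℂ)] (f : GL (Fin n) F → ℂ) :
    ∑ lam : MulChar F ℂ, ∑ M : GL (Fin n) F, lam (M : Matrix (Fin n) (Fin n) F).det * f M =
      ((Fintype.card F : ℂ) - 1) *
        ∑ M : SpecialLinearGroup (Fin n) F, f (SpecialLinearGroup.toGL M) := by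
  rw [Finset.sum_comm, Finset.mul_sum]
  simp only [← Finset.sum_mul, sum_mulChar]
  refine (Finset.sum_of_injOn SpecialLinearGroup.toGL
    SpecialLinearGroup.toGL_injective.injOn (fun _ _ => Finset.mem_coe.2 (Finset.mem_univ _))
    (fun M _ hM => ?_) fun M _ => ?_).symm
  · rw [if_neg, zero_mul]
    exact fun hdet => hM ⟨⟨M, hdet⟩, Finset.mem_coe.2 (Finset.mem_univ _), Units.ext rfl⟩
  · rw [if_pos (by simp)]

lemma card_GL_eq_mul_card_SL (hn : n ≠ 0) :
    (Nat.card (GL (Fin n) F) : ℂ) =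
      ((Fintype.card F : ℂ) - 1) * Nat.card (SpecialLinearGroup (Fin n) F) := by
  have : Fintype (MulChar F ℂ) := Fintype.ofFinite _
  have h := sum_mulChar_det_mul (fun _ : GL (Fin n) F => 1)
  simp only [mul_one] at h
  rw [Finset.sum_eq_single_of_mem 1 (Finset.mem_univ _)
    fun lam _ hlam => sum_mulChar_det_eq_zero hn hlam] at h
  simpa [MulChar.one_apply, GeneralLinearGroup.det_ne_zero, Nat.card_eq_fintype_card]
    using h

lemma sum_addChar_dotProduct {ψ : AddChar F ℂ} (hψ : ψ.IsPrimitive) {k : ℕ} (x : Fin k → F) :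
    ∑ t : Fin k → F, ψ (∑ i, t i * x i) = if x = 0 then (Fintype.card F : ℂ) ^ k else 0 := by
  have h : ∑ t : Fin k → F, ψ (∑ i, t i * x i) = ∏ i, ∑ a : F, ψ (a * x i) := by
    rw [Finset.prod_univ_sum, Fintype.piFinset_univ]
    exact Finset.sum_congr rfl fun t _ =>
      map_prod ψ.toMonoidHom (fun i => Multiplicative.ofAdd (t i * x i)) _
  rw [h]
  simp only [AddChar.sum_mulShift _ hψ]
  split_ifs with hx
  · simp [hx]
  · obtain ⟨i, hi⟩ := Function.ne_iff.1 hx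
    exact Finset.prod_eq_zero (Finset.mem_univ i) (by simpa using hi)

end LinearGroupMeans

section Equidistribution

variable {F : Type*} [Field F] [Fintype F] [DecidableEq F] {n k : ℕ}

/-- The mean over `GL n F` of the product of a multiplicative character of the determinant and an
additive character of a linear combination of the traces of the `b i`-th powers. -/
noncomputable def traceMean (ψ : AddChar F ℂ) (b : Fin k → ℤ) (n : ℕ) (lam : MulChar F ℂ)
    (t : Fin k → F) : ℂ :=
  (∑ M : GL (Fin n) F, lam (M : Matrix (Fin n) (Fin n) F).det *
    ψ (∑ i, t i * ((M ^ b i : GL (Fin n) F) : Matrix (Fin n) (Fin n) F).trace)) /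
      (Nat.card (GL (Fin n) F) : ℂ)

variable {ψ : AddChar F ℂ} {b : Fin k → ℤ}

lemma norm_traceMean_le (p : ℕ) [Fact p.Prime] [CharP F p] (hψ : ψ.IsPrimitive)
    (hb : b.Injective) (hbp : ∀ i, ¬ (p : ℤ) ∣ b i) {d l m : ℕ} (hd : 1 ≤ d) (hlm : l + m ≤ d)
    (hl : ∀ i, b i ≤ l) (hm : ∀ i, -(m : ℤ) ≤ b i) (lam : MulChar F ℂ) {t : Fin k → F}
    (ht : t ≠ 0) :
    ‖traceMean ψ b n lam t‖ ≤ (Fintype.card F : ℝ) ^ (-(n : ℝ) ^ 2 / (2 * (d : ℝ))) *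
      (1 + 1 / ((Fintype.card F : ℝ) - 1)) ^ n * ((n + d).choose n : ℝ) := by
  have : CharP (AlgebraicClosure F) p :=
    charP_of_injective_algebraMap (algebraMap F (AlgebraicClosure F)).injective p
  obtain ⟨s, hs⟩ := LinearMap.exists_leftInverse_of_injective
    (Algebra.linearMap F (AlgebraicClosure F))
    (LinearMap.ker_eq_bot.2 (algebraMap F (AlgebraicClosure F)).injective)
  replace hs : ∀ x, s (algebraMap F (AlgebraicClosure F) x) = x := LinearMap.congr_fun hs
  have hmean : traceMean ψ b n lam t = matrixMean
      (traceChar ψ lam s (laurentEval b (algebraMap F (AlgebraicClosure F) ∘ t))) n := by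
    rw [matrixMean_eq_sum_GL fun M => traceChar_charpoly_eq_zero, traceMean]
    simp only [traceChar_charpoly hs]
  rw [hmean]
  refine norm_le_of_recursion (by exact_mod_cast Fintype.one_lt_card) hd (matrixMean_zero _)
    (monicSum_zero _) (fun r => (norm_monicSum_traceChar_le p hψ hs hb hbp ht hl hm lam r).trans ?_)
    (fun n => ?_) n
  · gcongr
  · exact_mod_cast matrixMean_recursion _ n

lemma traceMean_zero_right (hn : n ≠ 0) (lam : MulChar F ℂ) :
    traceMean ψ b n lam 0 = if lam = 1 then 1 else 0 := by
  have hcard : (Nat.card (GL (Fin n) F) : ℂ) ≠ 0 := by exact_mod_cast Nat.card_pos.ne'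
  simp only [traceMean, Pi.zero_apply, zero_mul, Finset.sum_const_zero, AddChar.map_zero_eq_one,
    mul_one]
  split_ifs with h
  · rw [div_eq_one_iff_eq hcard]
    simp [h, MulChar.one_apply, GeneralLinearGroup.det_ne_zero, Nat.card_eq_fintype_card]
  · rw [sum_mulChar_det_eq_zero hn h, zero_div]

lemma ncard_SL_div_card (hψ : ψ.IsPrimitive) [Fintype (MulChar F ℂ)] (hn : n ≠ 0)
    (a : Fin k → F) :
    ({M : SpecialLinearGroup (Fin n) F | ∀ i, Matrix.trace
      ((M ^ b i : SpecialLinearGroup (Fin n) F) : Matrix (Fin n) (Fin n) F) = a i}.ncard : ℂ) /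
        Nat.card (SpecialLinearGroup (Fin n) F) = (∑ t : Fin k → F, ∑ lam : MulChar F ℂ,
          ψ (-∑ i, t i * a i) * traceMean ψ b n lam t) / (Fintype.card F : ℂ) ^ k := by
  have hSL : (Nat.card (SpecialLinearGroup (Fin n) F) : ℂ) ≠ 0 := by
    exact_mod_cast Nat.card_pos.ne'
  have hq0 : (Fintype.card F : ℂ) ≠ 0 := by exact_mod_cast Fintype.card_pos.ne'
  have hq1 : (Fintype.card F : ℂ) - 1 ≠ 0 :=
    sub_ne_zero.2 (by exact_mod_cast (Fintype.one_lt_card (α := F)).ne')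
  have hcount : (Fintype.card F : ℂ) ^ k *
      ({M : SpecialLinearGroup (Fin n) F | ∀ i, Matrix.trace
        ((M ^ b i : SpecialLinearGroup (Fin n) F) : Matrix (Fin n) (Fin n) F) = a i}.ncard : ℂ) =
      ∑ t : Fin k → F, ψ (-∑ i, t i * a i) * ∑ M : SpecialLinearGroup (Fin n) F,
        ψ (∑ i, t i * Matrix.trace
          ((M ^ b i : SpecialLinearGroup (Fin n) F) : Matrix (Fin n) (Fin n) F)) := by
    simp only [Finset.mul_sum, ← AddChar.map_add_eq_mul]
    rw [Finset.sum_comm]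
    have h (M : SpecialLinearGroup (Fin n) F) : ∑ t : Fin k → F, ψ (-∑ i, t i * a i +
        ∑ i, t i * Matrix.trace
          ((M ^ b i : SpecialLinearGroup (Fin n) F) : Matrix (Fin n) (Fin n) F)) =
        if ∀ i, Matrix.trace
          ((M ^ b i : SpecialLinearGroup (Fin n) F) : Matrix (Fin n) (Fin n) F) = a i
        then (Fintype.card F : ℂ) ^ k else 0 := by
      have := sum_addChar_dotProduct hψ fun i => Matrix.trace
          ((M ^ b i : SpecialLinearGroup (Fin n) F) : Matrix (Fin n) (Fin n) F) - a i
      simp only [funext_iff, Pi.zero_apply, sub_eq_zero] at this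
      rw [← this]
      refine Finset.sum_congr rfl fun t _ => ?_
      rw [neg_add_eq_sub, ← Finset.sum_sub_distrib]
      simp only [mul_sub]
    simp only [h]
    rw [← Finset.sum_filter, Finset.sum_const, nsmul_eq_mul, mul_comm, ← Set.ncard_coe_finset,
      Finset.coe_filter]
    simp only [Finset.mem_univ, true_and]
  have htoGL (M : SpecialLinearGroup (Fin n) F) (j : ℤ) :
      ((SpecialLinearGroup.toGL M ^ j : GL (Fin n) F) : Matrix (Fin n) (Fin n) F) =
        ((M ^ j : SpecialLinearGroup (Fin n) F) : Matrix (Fin n) (Fin n) F) := by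
    rw [← map_zpow]
    rfl
  have hsum (t : Fin k → F) : ∑ lam : MulChar F ℂ, traceMean ψ b n lam t =
      (∑ M : SpecialLinearGroup (Fin n) F, ψ (∑ i, t i * Matrix.trace
          ((M ^ b i : SpecialLinearGroup (Fin n) F) : Matrix (Fin n) (Fin n) F))) /
        Nat.card (SpecialLinearGroup (Fin n) F) := by
    simp only [traceMean, ← Finset.sum_div]
    rw [sum_mulChar_det_mul fun M => ψ (∑ i, t i *
      ((M ^ b i : GL (Fin n) F) : Matrix (Fin n) (Fin n) F).trace), card_GL_eq_mul_card_SL hn,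
      mul_div_mul_left _ _ hq1]
    simp only [htoGL]
  simp only [← Finset.mul_sum, hsum, mul_div_assoc', ← Finset.sum_div]
  rw [← hcount]
  field_simp

lemma norm_ncard_SL_div_card_sub_le (hψ : ψ.IsPrimitive) (hn : n ≠ 0) (a : Fin k → F) {B : ℝ}
    (hB : ∀ (lam : MulChar F ℂ) (t : Fin k → F), t ≠ 0 → ‖traceMean ψ b n lam t‖ ≤ B)
    (hB0 : 0 ≤ B) :
    ‖({M : SpecialLinearGroup (Fin n) F | ∀ i, Matrix.trace
      ((M ^ b i : SpecialLinearGroup (Fin n) F) : Matrix (Fin n) (Fin n) F) = a i}.ncard : ℂ) /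
        Nat.card (SpecialLinearGroup (Fin n) F) - 1 / (Fintype.card F : ℂ) ^ k‖ ≤
      ((Fintype.card F : ℝ) - 1) * B := by
  have : Fintype (MulChar F ℂ) := Fintype.ofFinite _
  have hcard : (Fintype.card (MulChar F ℂ) : ℝ) = (Fintype.card F : ℝ) - 1 := by
    have := sum_mulChar (1 : F)
    simp only [map_one, if_true, Finset.sum_const, Finset.card_univ, nsmul_eq_mul, mul_one] at this
    exact_mod_cast this
  have hq : (0 : ℝ) < (Fintype.card F : ℝ) ^ k := by
    have : 0 < Fintype.card F := Fintype.card_pos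
    positivity
  rw [ncard_SL_div_card hψ hn, ← sub_div, norm_div, norm_pow, Complex.norm_natCast, div_le_iff₀ hq,
    ← Finset.add_sum_erase _ _ (Finset.mem_univ 0)]
  simp only [traceMean_zero_right hn, Pi.zero_apply, zero_mul, Finset.sum_const_zero, neg_zero,
    AddChar.map_zero_eq_one, one_mul, Finset.sum_ite_eq', Finset.mem_univ, if_true,
    add_sub_cancel_left]
  calc _ ≤ ∑ t ∈ Finset.univ.erase (0 : Fin k → F), ∑ _lam : MulChar F ℂ, B := by
        refine norm_sum_le_of_le _ fun t ht => norm_sum_le_of_le _ fun lam _ => ?_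
        rw [norm_mul, AddChar.norm_apply, one_mul]
        exact hB lam t (Finset.ne_of_mem_erase ht)
    _ ≤ ∑ _t : Fin k → F, ∑ _lam : MulChar F ℂ, B :=
        Finset.sum_le_sum_of_subset_of_nonneg (Finset.erase_subset _ _) fun _ _ _ => by positivity
    _ = _ := by
        simp only [Finset.sum_const, Finset.card_univ, nsmul_eq_mul, Fintype.card_fun,
          Fintype.card_fin, Nat.cast_pow, hcard]
        ring

end Equidistribution

end TraceEquidistribution

/-- Gorodetsky–Rodgers bound with negative powers for `SL_n` over a finite field `F` with
`q` elements and odd characteristic `p`: for strictly increasing integers `b₁ < … < b_k`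
coprime with `p` and `d = max(b_k,0) − min(b₁,0) + 1`, for any `a₁,…,a_k ∈ F`, the
probability that a uniform `M ∈ SL_n(F)` has `tr(M^{b_i}) = a_i` for all `i` differs from
`q^{−k}` by at most `q^{−n²/(2d)} (q−1) (1 + 1/(q−1))^n C(n+d,n)`. -/
theorem stmt_18 {F : Type*} [Field F] [Fintype F] (p : ℕ) [Fact p.Prime] (hp : Odd p)
    [CharP F p] (q : ℕ) (hq : q = Fintype.card F)
    (n k : ℕ) (hk : 1 ≤ k) (b : Fin k → ℤ) (hb : StrictMono b)
    (hbp : ∀ i : Fin k, ¬ (p : ℤ) ∣ b i)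
    (d : ℕ)
    (hd : (d : ℤ) = max (b ⟨k - 1, by omega⟩) 0 - min (b ⟨0, by omega⟩) 0 + 1)
    (a : Fin k → F) :
    |(({M : Matrix.SpecialLinearGroup (Fin n) F | ∀ i : Fin k,
          Matrix.trace ((M ^ (b i) : Matrix.SpecialLinearGroup (Fin n) F) :
            Matrix (Fin n) (Fin n) F) = a i}.ncard : ℝ) /
        (Nat.card (Matrix.SpecialLinearGroup (Fin n) F) : ℝ) - (q : ℝ) ^ (-(k : ℝ)))| ≤
      (q : ℝ) ^ (-(n : ℝ) ^ 2 / (2 * (d : ℝ))) * ((q : ℝ) - 1) *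
        (1 + 1 / ((q : ℝ) - 1)) ^ n * (Nat.choose (n + d) n : ℝ) := by
  classical
  subst hq
  set q := Fintype.card F with hq
  have hq3 : 3 ≤ q := by
    have hp3 : 3 ≤ p := by
      have h2 := (Fact.out : p.Prime).two_le
      have : p ≠ 2 := by rintro rfl; exact absurd hp (by decide)
      omega
    obtain ⟨e, _, he⟩ := FiniteField.card F p
    rw [hq, he]
    exact hp3.trans (Nat.le_self_pow e.ne_zero p)
  have hqR : (3 : ℝ) ≤ q := by exact_mod_cast hq3
  have hqk : (q : ℝ) ^ (-(k : ℝ)) = 1 / (q : ℝ) ^ k := by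
    rw [Real.rpow_neg (by positivity), Real.rpow_natCast, one_div]
  rcases eq_or_ne n 0 with rfl | hn
  · have h1 : (q : ℝ) ^ (-(k : ℝ)) ≤ 1 := by
      rw [hqk, one_div]
      exact inv_le_one_of_one_le₀ (one_le_pow₀ (by linarith))
    have h2 : (0 : ℝ) ≤ (q : ℝ) ^ (-(k : ℝ)) := by positivity
    set S : Set (Matrix.SpecialLinearGroup (Fin 0) F) := {M | ∀ i : Fin k, Matrix.trace
      ((M ^ (b i) : Matrix.SpecialLinearGroup (Fin 0) F) : Matrix (Fin 0) (Fin 0) F) = a i}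
    have h3 : (S.ncard : ℝ) / (Nat.card (Matrix.SpecialLinearGroup (Fin 0) F) : ℝ) ≤ 1 :=
      div_le_one_of_le₀ (by exact_mod_cast Set.ncard_le_card S) (by positivity)
    have h4 : 0 ≤ (S.ncard : ℝ) / (Nat.card (Matrix.SpecialLinearGroup (Fin 0) F) : ℝ) := by
      positivity
    calc _ ≤ (1 : ℝ) := abs_le.2 ⟨by linarith, by linarith⟩
      _ ≤ q - 1 := by linarith
      _ = _ := by simp
  have hfirst : ∀ i, b ⟨0, by omega⟩ ≤ b i := fun i => hb.monotone (Nat.zero_le _)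
  have hlast : ∀ i, b i ≤ b ⟨k - 1, by omega⟩ := fun i => hb.monotone (Nat.le_sub_one_of_lt i.2)
  obtain ⟨l, hl⟩ := Int.eq_ofNat_of_zero_le (le_max_right (b ⟨k - 1, by omega⟩) 0)
  obtain ⟨m, hm⟩ := Int.eq_ofNat_of_zero_le (neg_nonneg.2 (min_le_right (b ⟨0, by omega⟩) 0))
  have hψ := AddChar.FiniteField.primitiveChar_to_Complex_isPrimitive F
  have hbound := TraceEquidistribution.norm_ncard_SL_div_card_sub_le (n := n) (b := b) hψ hn a
    (fun lam t ht => TraceEquidistribution.norm_traceMean_le (d := d) (l := l) (m := m) p hψ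
      hb.injective hbp (by omega) (by omega) (fun i => by have := hlast i; omega)
      (fun i => by have := hfirst i; omega) lam ht)
    (by rw [← hq]; have : (0 : ℝ) < q - 1 := by linarith
        positivity)
  rw [← hq] at hbound
  rw [hqk, ← Real.norm_eq_abs, ← Complex.norm_real]
  push_cast
  exact hbound.trans_eq (by ring)
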